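/- arXiv:1411.7573 — 6 statements merged into one kernel-verified Lean document; each statement's English description precedes it below -/
import Mathlib

section
/- For every c > 3^{4/3}/2, every p ∈ ℝ², and every q ∈ 𝔯 with H_{c,p}(q) = 0, one has uᵀ 𝓗(q) u > 0, where u = J∇H_{c,p}(q) = (q₂ + q₂/|q|³ + p₁, 2q₁ - q₁/|q|³ + p₂) is the rotation by π/2 of the gradient of H_{c,p} at q and 𝓗(q) is the Hessian of H_{c,p} at q. -/
open Matrix

noncomputable section

/-- Euclidean norm of a point of `ℝ²`. -/
def nrm (q : ℝ × ℝ) : ℝ := Real.sqrt (q.1 ^ 2 + q.2 ^ 2)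

/-- Hill's region `𝔯`. -/
def HillRegion : Set (ℝ × ℝ) :=
  {q | (3:ℝ) ^ ((4:ℝ)/3) / 2 < 1 / nrm q + (3/2) * q.1 ^ 2 ∧
       |q.1| < (3:ℝ) ^ (-(1:ℝ)/3) ∧ |q.2| < 2 * (3:ℝ) ^ (-(4:ℝ)/3)}

/-- The Hessian matrix `𝓗(q)` of `H_{c,p}` at `q`. -/
def Hmat (q : ℝ × ℝ) : Matrix (Fin 2) (Fin 2) ℝ :=
  (1 / (nrm q) ^ 5) •
    !![-2 * (nrm q) ^ 5 + (nrm q) ^ 2 - 3 * q.1 ^ 2, -3 * q.1 * q.2;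
       -3 * q.1 * q.2, (nrm q) ^ 5 + (nrm q) ^ 2 - 3 * q.2 ^ 2]

/-- The function `H_{c,p}` (the Hamiltonian of Hill's lunar problem shifted by `c`,
as a function of the position `q` for fixed momentum `p`). -/
def Hcp (c : ℝ) (p : ℝ × ℝ) (q : ℝ × ℝ) : ℝ :=
  (1/2) * (p.1 ^ 2 + p.2 ^ 2) + p.1 * q.2 - p.2 * q.1
    - q.1 ^ 2 + (1/2) * q.2 ^ 2 - 1 / nrm q + c

lemma key_poly (w t : ℝ) (hw : 0 ≤ w) (ht : 0 ≤ t) (A B2 C BV1 g k : ℝ)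
    (hk : k = (1+w)^3)
    (hA : A = -2+3*k-9*k*(1-t)+32*k) (hC : C = 1+3*k-9*k*t+32*k)
    (hB2 : B2 = 81*k^2*(1-t)*t) (hBV : BV1 = -9*k^2*(1-k)*(1-t)*t)
    (hg : g = ((1-t)+2*(1+w)^3-3*(1+w)^2)/3) :
    0 ≤ (A*C-B2)*(k^2*t+(1-k)^2*(1-t)-g)
        - 32*k*(C*(k^2*t) - 2*BV1 + A*((1-k)^2*(1-t))) := by
  have : (A*C-B2)*(k^2*t+(1-k)^2*(1-t)-g)
        - 32*k*(C*(k^2*t) - 2*BV1 + A*((1-k)^2*(1-t))) = 324*w^0*t^2 + 288*w^1*t^1 + 1998*w^1*t^2 + 1920*w^2*t^1 + 5076*w^2*t^2 + 576*w^3*t^0 + 5664*w^3*t^1 + 6822*w^3*t^2 + 4944*w^4*t^0 + 9677*w^4*t^1 + 5130*w^4*t^2 + 17688*w^5*t^0 + 10421*w^5*t^1 + 2052*w^5*t^2 + 34930*w^6*t^0 + 21640/3*w^6*t^1 + 342*w^6*t^2 + 42320*w^7*t^0 + 3132*w^7*t^1 + 32836*w^8*t^0 + 783*w^8*t^1 +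 49252/3*w^9*t^0 + 87*w^9*t^1 + 5148*w^10*t^0 + 936*w^11*t^0 + 78*w^12*t^0 := by
    subst hk hA hC hB2 hBV hg
    ring
  rw [this]
  positivity

lemma quad_aux (A B C l v1 v2 g u1 u2 : ℝ) (hA : 0 < A) (hD : 0 < A*C-B^2) (hl : 0 < l)
    (hK : 0 ≤ (A*C-B^2)*(v1^2+v2^2-g) - l*(C*v1^2-2*(B*v1*v2)+A*v2^2)) :
    0 ≤ A*u1^2+2*B*u1*u2+C*u2^2-2*l*(u1*v1+u2*v2)+l*(v1^2+v2^2-g) := by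
  have h1 : 0 < A*(A*C-B^2) := mul_pos hA hD
  refine nonneg_of_mul_nonneg_right (a := A*(A*C-B^2)) ?_ h1
  have : A*(A*C-B^2)*(A*u1^2+2*B*u1*u2+C*u2^2-2*l*(u1*v1+u2*v2)+l*(v1^2+v2^2-g))
    = (A*C-B^2)*(A*u1+B*u2-l*v1)^2 + ((A*C-B^2)*u2-l*(A*v2-B*v1))^2
      + A*l*((A*C-B^2)*(v1^2+v2^2-g) - l*(C*v1^2-2*(B*v1*v2)+A*v2^2)) := by ring
  rw [this]
  have := mul_nonneg (mul_pos hA hl).le hK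
  have := mul_nonneg hD.le (sq_nonneg (A*u1+B*u2-l*v1))
  positivity

lemma core (h c s d1 d2 k : ℝ) (hh : 1 < h) (hk : k = h^3) (hcs : c^2+s^2=1)
    (hd : d1^2+d2^2 < (c^2+2*h^3-3*h^2)/3) :
    0 < (-2+3*k-9*k*c^2)*(d1+k*s)^2 + 2*(-9*k*c*s)*(d1+k*s)*(d2+(1-k)*c)
      + (1+3*k-9*k*s^2)*(d2+(1-k)*c)^2 := by
  have hk1 : 1 < k := by rw [hk]; exact one_lt_pow₀ hh (by norm_num)
  have hc : c^2 = 1 - s^2 := by linarith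
  have hs0 := sq_nonneg s
  have hc0 := sq_nonneg c
  have hA : 0 < -2+3*k-9*k*c^2+32*k := by
    rw [hc]; nlinarith [mul_nonneg (by linarith : 0 ≤ k) hs0]
  have hK := key_poly (h-1) (s^2) (by linarith) hs0 (-2+3*k-9*k*c^2+32*k) ((-9*k*c*s)^2)
    (1+3*k-9*k*s^2+32*k) ((-9*k*c*s)*(k*s)*((1-k)*c)) ((c^2+2*h^3-3*h^2)/3) k
    (by rw [hk]; ring) (by rw [hc]) rfl
    (by linear_combination (81*k^2*s^2)*hc) (by linear_combination (-9*k^2*(1-k)*s^2)*hc)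
    (by rw [hc]; ring)
  have hD : 0 < (-2+3*k-9*k*c^2+32*k)*(1+3*k-9*k*s^2+32*k)-(-9*k*c*s)^2 := by
    have : (-2+3*k-9*k*c^2+32*k)*(1+3*k-9*k*s^2+32*k)-(-9*k*c*s)^2
      = 910*k^2 - 44*k + 27*k*s^2 - 2 := by
      linear_combination (-9*k - 315*k^2)*hc
    rw [this]
    nlinarith [mul_nonneg (by linarith : 0 ≤ k) hs0]
  have := quad_aux _ (-9*k*c*s) _ (32*k) (k*s) ((1-k)*c) ((c^2+2*h^3-3*h^2)/3)
    (d1+k*s) (d2+(1-k)*c) hA hD (by linarith) (by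
      convert hK using 1
      linear_combination (-((-2+3*k-9*k*c^2+32*k)*(1+3*k-9*k*s^2+32*k)-(-9*k*c*s)^2)*(-(1-k)^2)
        - 32*k*(-2+3*k-9*k*c^2+32*k)*(1-k)^2)*hc)
  have h2 : 0 < 32*k*((c^2+2*h^3-3*h^2)/3 - (d1^2+d2^2)) := by
    apply mul_pos <;> linarith
  nlinarith [this, h2]

/-- For every `c > 3^{4/3}/2`, every `p ∈ ℝ²` and every `q` in Hill's region with
`H_{c,p}(q) = 0`, the tangential Hessian is positive:
`(J∇H_{c,p}(q))ᵀ 𝓗(q) (J∇H_{c,p}(q)) > 0`. -/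
theorem tangential_hessian_positive (c : ℝ) (hc : (3:ℝ) ^ ((4:ℝ)/3) / 2 < c)
    (p : ℝ × ℝ) (q : ℝ × ℝ) (hq : q ∈ HillRegion) (hH : Hcp c p q = 0) :
    0 < (![q.2 + q.2 / (nrm q) ^ 3 + p.1, 2 * q.1 - q.1 / (nrm q) ^ 3 + p.2]) ⬝ᵥ
        (Hmat q).mulVec
          (![q.2 + q.2 / (nrm q) ^ 3 + p.1, 2 * q.1 - q.1 / (nrm q) ^ 3 + p.2]) := by
  obtain ⟨x, y⟩ := q
  obtain ⟨p1, p2⟩ := p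
  obtain ⟨h1, h2, -⟩ := hq
  simp only [Hcp] at hH
  simp only at h1 h2
  obtain ⟨m, hm⟩ : ∃ m : ℝ, m = (3:ℝ)^((1:ℝ)/3) := ⟨_, rfl⟩
  have hm0 : 0 < m := by rw [hm]; positivity
  have hm3 : m^3 = 3 := by
    rw [hm, ← Real.rpow_natCast, ← Real.rpow_mul (by norm_num)]; norm_num
  have e1 : (3:ℝ)^((4:ℝ)/3) = 3*m := by
    rw [hm, show (4:ℝ)/3 = 1 + 1/3 by norm_num, Real.rpow_add (by norm_num), Real.rpow_one]
  have e2 : (3:ℝ)^(-(1:ℝ)/3) = m⁻¹ := by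
    rw [hm, ← Real.rpow_neg (by norm_num)]; norm_num
  rw [e1] at hc h1
  rw [e2] at h2
  have hx2 : x^2 < m/3 := by
    have : x^2 < (m⁻¹)^2 := by
      rw [← sq_abs]; gcongr
    have e : (m⁻¹)^2 = m/3 := by rw [← hm3]; field_simp
    linarith
  have hr2 : nrm (x,y)^2 = x^2+y^2 := by
    simp only [nrm]; exact Real.sq_sqrt (by positivity)
  have hr0 : 0 ≤ nrm (x,y) := by simp only [nrm]; positivity
  simp only [Hmat]
  generalize nrm (x,y) = r at *
  have hir : m < 1/r := by linarith
  have hr : 0 < r := by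
    rcases hr0.eq_or_lt with h | h
    · rw [← h] at hir; norm_num at hir; linarith
    · exact h
  have hh : 1 < 1/(m*r) := by
    rw [lt_div_iff₀ (by positivity)]
    rw [lt_div_iff₀ hr] at hir
    linarith
  have hk : 1/(3*r^3) = (1/(m*r))^3 := by rw [div_pow, mul_pow, hm3]; norm_num
  have hcs : (x/r)^2+(y/r)^2 = 1 := by
    rw [div_pow, div_pow, ← add_div, ← hr2]; field_simp
  have hab : (p1+y)^2+(p2-x)^2 < 3*x^2+2/r-3*m := by
    have : 2/r = 2*(1/r) := by ring
    rw [this]; linarith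
  have hF : 0 < 1/(m^3*r)/(m^3*r) := by positivity
  have hd : ((p1+y)/(m^3*r))^2+((p2-x)/(m^3*r))^2
      < ((x/r)^2+2*(1/(m*r))^3-3*(1/(m*r))^2)/3 := by
    have := mul_lt_mul_of_pos_left hab hF
    have e3 : 1/(m^3*r)/(m^3*r)*((p1+y)^2+(p2-x)^2)
      = ((p1+y)/(m^3*r))^2+((p2-x)/(m^3*r))^2 := by field_simp
    have e4 : 1/(m^3*r)/(m^3*r)*(3*x^2+2/r-3*m)
      = ((x/r)^2+2*(1/(m*r))^3-3*(1/(m*r))^2)/3 := by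
      have e5 : (1/(m*r))^2 = m/(3*r^2) := by rw [← hm3]; field_simp
      rw [e5, ← hk, hm3]; field_simp
    rw [e3, e4] at this
    exact this
  have hcore := core (1/(m*r)) (x/r) (y/r) _ _ (1/(3*r^3)) hh hk hcs hd
  have hfin := mul_pos (by positivity : 0 < 9*r^2) hcore
  rw [hm3] at hfin
  refine lt_of_lt_of_eq hfin ?_
  simp [Matrix.mulVec, dotProduct, Fin.sum_univ_two]
  field_simp
  ring


end
end

section
/- For every q ∈ 𝔯 and every s ∈ ℝ² with s₁² + s₂² ≤ 3q₁² + 2/|q| - 3^{4/3}, one has (w(q)+s)ᵀ 𝓗(q) (w(q)+s) > 0. -/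
open Matrix

noncomputable section

/-- The vector `w(q) = (q₂/|q|³, 3q₁ - q₁/|q|³)`. -/
def w (q : ℝ × ℝ) : Fin 2 → ℝ := ![q.2 / (nrm q) ^ 3, 3 * q.1 - q.1 / (nrm q) ^ 3]

lemma g_pos (x u : ℝ) (hx : 0 < x) (hx1 : x < 1) (hu : 0 ≤ u) :
    0 < (1-x)^3 * (78+234*x+468*x^2+112/3*x^3-148*x^4-88*x^5-62/3*x^6+10*x^7+4*x^8+4/3*x^9)
      + u * ((1-x) * (87*x^3+87*x^4+87*x^5-23/3*x^6+58/3*x^7+58/3*x^8-4/3*x^9-4/3*x^10-4/3*x^11))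
      + u^2 * (342*x^6-18*x^9) := by
  have h1 : 0 < 1 - x := by linarith
  have p (n : ℕ) : 0 < x^n := pow_pos hx n
  have d (n m : ℕ) (h : n ≤ m) : x^m ≤ x^n := pow_le_pow_of_le_one hx.le hx1.le h
  have A : 0 < 78+234*x+468*x^2+112/3*x^3-148*x^4-88*x^5-62/3*x^6+10*x^7+4*x^8+4/3*x^9 := by
    linarith [p 3, p 7, p 8, p 9, p 2, d 2 4 (by norm_num), d 2 5 (by norm_num), d 2 6 (by norm_num)]
  have B : 0 < 87*x^3+87*x^4+87*x^5-23/3*x^6+58/3*x^7+58/3*x^8-4/3*x^9-4/3*x^10-4/3*x^11 := by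
    linarith [p 3, p 4, p 5, p 7, p 8, d 3 6 (by norm_num), d 3 9 (by norm_num),
      d 3 10 (by norm_num), d 3 11 (by norm_num)]
  have Cc : 0 < 342*x^6-18*x^9 := by linarith [p 6, d 6 9 (by norm_num)]
  have := pow_pos h1 3
  positivity

lemma core_s3 (x c n S1 S2 : ℝ) (hx : 0 < x) (hx1 : x < 1) (hcn : c^2 + n^2 = 1)
    (hS : S1^2 + S2^2 ≤ (2*x^3 + x^6*c^2 - 3*x^4)/3) :
    0 < (3-9*c^2-2*x^3) * (n+S1)^2 - 18*c*n*(n+S1)*(c*(x^3-1)+S2)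
      + (3-9*n^2+x^3) * (c*(x^3-1)+S2)^2 := by
  have hk0 : 0 < x^3 := pow_pos hx 3
  have hk1 : x^3 < 1 := pow_lt_one₀ hx.le hx1 (by norm_num)
  have hc : c^2 ≤ 1 := by nlinarith [sq_nonneg n]
  have hg := g_pos x (n^2) hx hx1 (sq_nonneg n)
  set D := (2*x^3 + x^6*c^2 - 3*x^4)/3 with hD
  set a := 35-9*c^2-2*x^3 with ha
  set d := 35-9*n^2+x^3 with hd
  set V1 := n+S1 with hV1
  set V2 := c*(x^3-1)+S2 with hV2
  have ha0 : 0 < a := by rw [ha]; linarith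
  have hΔ : a*d-(9*c*n)^2 = 1024-32*(3+x^3)+(-18+15*x^3-27*x^3*c^2-2*x^6) := by
    have hn : n^2 = 1-c^2 := by linarith
    rw [ha, hd, mul_pow, hn]; ring
  have hΔ0 : 0 < a*d-(9*c*n)^2 := by
    rw [hΔ]; nlinarith [mul_nonneg hk0.le (sub_nonneg.2 hc)]
  set g := -D*(a*d-(9*c*n)^2)
     + 32*((3-9*c^2-2*x^3) * n^2 - 18*c*n*n*(c*(x^3-1)) + (3-9*n^2+x^3) * (c*(x^3-1))^2)
     + (n^2+(c*(x^3-1))^2) * (a*d-(9*c*n)^2-1024+32*(3+x^3)) with hgd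
  have hg' : 0 < g := by
    refine lt_of_lt_of_eq hg ?_
    rw [hgd, hΔ, hD]
    have hc2 : c^2 = 1-n^2 := by linarith
    have e : c*n*n*(c*(x^3-1)) = c^2*n^2*(x^3-1) := by ring
    have e' : 18*c*n*n*(c*(x^3-1)) = 18*(c^2*n^2*(x^3-1)) := by ring
    rw [e', mul_pow, hc2]; ring
  have key : a*(a*d-(9*c*n)^2) * ((3-9*c^2-2*x^3) * V1^2 - 18*c*n*V1*V2
      + (3-9*n^2+x^3) * V2^2 + 32*(S1^2+S2^2-D))
      = (a*d-(9*c*n)^2) * (a*V1 - 9*c*n*V2-32*n)^2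
       + ((a*d-(9*c*n)^2)*V2 - 32*(a*(c*(x^3-1))+9*c*n*n))^2 + a*32*g := by
    have hS1 : S1 = V1 - n := by rw [hV1]; ring
    have hS2 : S2 = V2 - c*(x^3-1) := by rw [hV2]; ring
    have e1 : 3-9*c^2-2*x^3 = a - 32 := by rw [ha]; ring
    have e2 : 3-9*n^2+x^3 = d - 32 := by rw [hd]; ring
    have e3 : 32*(3+x^3) = 32*(64-a-d)+0 := by rw [ha, hd]; linear_combination (-288)*hcn
    rw [hgd, hS1, hS2, e1, e2, e3]
    clear_value V1 V2 a d D
    ring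
  have hp : 0 < a*(a*d-(9*c*n)^2) * ((3-9*c^2-2*x^3) * V1^2 - 18*c*n*V1*V2
      + (3-9*n^2+x^3) * V2^2 + 32*(S1^2+S2^2-D)) := by
    rw [key]; positivity
  have := pos_of_mul_pos_right hp (by positivity)
  linarith

/-- For every `q ∈ 𝔯` and every `s ∈ ℝ²` with `s₁² + s₂² ≤ 3q₁² + 2/|q| - 3^{4/3}`,
one has `(w(q)+s)ᵀ 𝓗(q) (w(q)+s) > 0`. -/
theorem fiberwise_convexity (q : ℝ × ℝ) (hq : q ∈ HillRegion) (s : Fin 2 → ℝ)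
    (hs : s 0 ^ 2 + s 1 ^ 2 ≤ 3 * q.1 ^ 2 + 2 / nrm q - (3:ℝ) ^ ((4:ℝ)/3)) :
    0 < (w q + s) ⬝ᵥ (Hmat q).mulVec (w q + s) := by
  obtain ⟨h1, h2, -⟩ := hq
  obtain ⟨κ, hκ⟩ : ∃ κ : ℝ, κ = (3:ℝ) ^ ((1:ℝ)/3) := ⟨_, rfl⟩
  have κ0 : 0 < κ := by rw [hκ]; positivity
  have κ3 : κ^3 = 3 := by
    rw [hκ, ← Real.rpow_natCast, ← Real.rpow_mul (by norm_num)]; norm_num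
  have e4 : (3:ℝ) ^ ((4:ℝ)/3) = 3*κ := by
    rw [hκ, show (4:ℝ)/3 = 1 + 1/3 by norm_num, Real.rpow_add (by norm_num), Real.rpow_one]
  have em : (3:ℝ) ^ (-(1:ℝ)/3) = κ⁻¹ := by
    rw [hκ, show -(1:ℝ)/3 = -(1/3) by norm_num, Real.rpow_neg (by norm_num)]
  rw [e4] at h1 hs
  rw [em] at h2
  obtain ⟨r, hr⟩ : ∃ r : ℝ, r = nrm q := ⟨_, rfl⟩
  have hr2 : r^2 = q.1^2+q.2^2 := by rw [hr, nrm, Real.sq_sqrt (by positivity)]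
  have hr0 : 0 ≤ r := by rw [hr, nrm]; positivity
  have hq1 : q.1^2 * κ^2 < 1 := by
    have : |q.1| * κ < 1 := by
      calc |q.1| * κ < κ⁻¹ * κ := by gcongr
        _ = 1 := by field_simp
    calc q.1^2 * κ^2 = (|q.1| * κ)^2 := by rw [mul_pow, sq_abs]
      _ < 1 := pow_lt_one₀ (by positivity) this (by norm_num)
  have hq1' : 3 * q.1^2 < κ := by
    have : κ * (q.1^2*κ^2) < κ * 1 := by gcongr
    nlinarith
  rw [← hr] at h1 hs
  have hrp : 0 < r := by
    rcases hr0.eq_or_lt with h | h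
    · rw [← h] at h1; simp at h1; linarith
    · exact h
  have hx1 : κ * r < 1 := by
    have : κ < 1 / r := by linarith
    rwa [lt_div_iff₀ hrp] at this
  have hrn : r ≠ 0 := hrp.ne'
  have hx3 : (κ*r)^3 = 3*r^3 := by rw [mul_pow, κ3]
  have hx4 : (κ*r)^4 = 3*κ*r^4 := by rw [mul_pow, show κ^4 = κ^3*κ by ring, κ3]
  have hx6 : (κ*r)^6 = 9*r^6 := by rw [mul_pow, show κ^6 = (κ^3)^2 by ring, κ3]; norm_num
  have C := core_s3 (κ*r) (q.1/r) (q.2/r) (r^2 * s 0) (r^2 * s 1) (by positivity) hx1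
    (by rw [div_pow, div_pow, ← add_div, ← hr2]; field_simp)
    (by
      rw [hx3, hx4, hx6]
      calc (r^2 * s 0)^2 + (r^2 * s 1)^2 = r^4 * (s 0 ^ 2 + s 1 ^ 2) := by ring
        _ ≤ r^4 * (3 * q.1 ^ 2 + 2 / r - 3*κ) := by gcongr
        _ = _ := by field_simp; ring)
  rw [hx3] at C
  have E : (w q + s) ⬝ᵥ (Hmat q).mulVec (w q + s) = (1/(3*r^7)) *
     ((3-9*(q.1/r)^2-2*(3*r^3)) * (q.2/r+r^2 * s 0)^2
      - 18*(q.1/r)*(q.2/r)*(q.2/r+r^2 * s 0)*((q.1/r)*(3*r^3-1)+r^2 * s 1)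
      + (3-9*(q.2/r)^2+3*r^3) * ((q.1/r)*(3*r^3-1)+r^2 * s 1)^2) := by
    simp only [w, Hmat, ← hr, dotProduct, mulVec, Fin.sum_univ_two, Matrix.smul_apply, Pi.add_apply,
      Matrix.of_apply, Matrix.cons_val_zero, Matrix.cons_val_one, smul_eq_mul, Matrix.cons_val']
    field_simp
    ring
  rw [E]
  exact mul_pos (by positivity) C

end
end

section
/- For every q ∈ 𝔯 with |q| < 0.54 and every s ∈ ℝ² with s₁² + s₂² ≤ 3q₁² + 2/|q| - 3^{4/3}, one has (w(q)+s)ᵀ 𝓗(q) (w(q)+s) ≥ φ(r), where r = |q| and φ(r) = (11/12)r^{-7} - (10/3)r^{-4} - (29/6)r^{-1} + 4r² - (3/4)r⁵ - 2(r^{-5} - 2r^{-2})·√(3r² + 2/r - 3^{4/3}) - (2 + 2r^{-3})·(3r² + 2/r - 3^{4/3}). Moreover, φ(r) > 0 for every r ∈ (0, 0.54). -/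
open Matrix

noncomputable section

/-- The lower-bound function `φ(r)` of Step 1. -/
def φLB (r : ℝ) : ℝ :=
  (11/12) / r ^ 7 - (10/3) / r ^ 4 - (29/6) / r + 4 * r ^ 2 - (3/4) * r ^ 5
    - 2 * (1 / r ^ 5 - 2 / r ^ 2) * Real.sqrt (3 * r ^ 2 + 2 / r - (3:ℝ) ^ ((4:ℝ)/3))
    - (2 + 2 / r ^ 3) * (3 * r ^ 2 + 2 / r - (3:ℝ) ^ ((4:ℝ)/3))


lemma aux_K_lo : (4.326:ℝ) < (3:ℝ) ^ ((4:ℝ)/3) := by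
  have h3 : ((3:ℝ) ^ ((4:ℝ)/3)) ^ 3 = 81 := by
    rw [← Real.rpow_natCast, ← Real.rpow_mul (by norm_num)]; norm_num
  have h0 : 0 ≤ (3:ℝ) ^ ((4:ℝ)/3) := by positivity
  exact lt_of_pow_lt_pow_left₀ 3 h0 (by rw [h3]; norm_num)

lemma aux_K_hi : (3:ℝ) ^ ((4:ℝ)/3) < (4.327:ℝ) := by
  have h3 : ((3:ℝ) ^ ((4:ℝ)/3)) ^ 3 = 81 := by
    rw [← Real.rpow_natCast, ← Real.rpow_mul (by norm_num)]; norm_num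
  exact lt_of_pow_lt_pow_left₀ 3 (by norm_num) (by rw [h3]; norm_num)

/-- radicand nonnegative -/
lemma aux_rad (r K : ℝ) (h0 : 0 < r) (h1 : r < 0.54) (hK : K < 4.327) :
    0 ≤ 3 * r ^ 2 + 2 / r - K := by
  have : 0 ≤ (3 * r ^ 3 + 2 - K * r) / r := by
    apply div_nonneg _ h0.le
    nlinarith [mul_nonneg h0.le (sq_nonneg (r - 0.6)), mul_pos h0 (sub_pos.2 hK)]
  have e : (3 * r ^ 3 + 2 - K * r) / r = 3 * r ^ 2 + 2 / r - K := by field_simp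
  linarith

lemma aux_y_max (r : ℝ) (h0 : 0 < r) (h1 : r < 0.54) :
    3 * r ^ 6 + 2 * r ^ 3 - 4.326 * r ^ 4 ≤ 0.0304 := by
  obtain ⟨b, hb⟩ : ∃ b : ℝ, b = 0.54 - r := ⟨_, rfl⟩
  have hb0 : 0 < b := by linarith
  have key : 0 ≤ (r - 0.428)^2 * (126575222/66430125 * r^0 * b^4 + 827863706/66430125 * r^1 * b^3 + 778024072/22143375 * r^2 * b^2 + 2374942052/66430125 * r^3 * b^1 + 108573589/13286025 * r^4 * b^0) := by positivity
  rw [hb] at key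
  ring_nf at key ⊢
  linarith

lemma aux_poly (r : ℝ) (h0 : 0 < r) (h1 : r < 0.54) :
    0 < 11/12 - 10/3 * r^3 - 29/6 * r^6 + 4 * r^9 - 3/4 * r^12
      - (1 - 2 * r^3) * ((3 * r ^ 6 + 2 * r ^ 3 - 4.326 * r ^ 4) / 0.15 + 0.15)
      - 2 * (1 + r^3) * (3 * r ^ 6 + 2 * r ^ 3 - 4.326 * r ^ 4) := by
  obtain ⟨b, hb⟩ : ∃ b : ℝ, b = 0.54 - r := ⟨_, rfl⟩
  have hb0 : 0 < b := by linarith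
  have key : 0 < 561523437500000000000/450283905890997363 * r^0 * b^12
      + 2246093750000000000000/150094635296999121 * r^1 * b^11
      + 12353515625000000000000/150094635296999121 * r^2 * b^10
      + 121186266992187500000000/450283905890997363 * r^3 * b^9
      + 28794337122031250000000/50031545098999707 * r^4 * b^8
      + 42094004007500000000000/50031545098999707 * r^5 * b^7
      + 128923617719476562500000/150094635296999121 * r^6 * b^6
      + 30905807829074303750000/50031545098999707 * r^7 * b^5
      + 15645659846426206250000/50031545098999707 * r^8 * b^4
      + 49319372584910902250000/450283905890997363 * r^9 * b^3
      + 3724040057444864750000/150094635296999121 * r^10 * b^2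
      + 436639112525621000000/150094635296999121 * r^11 * b^1
      + 107162486132771007911/1801135623563989452 * r^12 * b^0 := by positivity
  rw [hb] at key
  ring_nf at key ⊢
  linarith

lemma aux_u (r : ℝ) (h0 : 0 < r) (h1 : r < 0.54) : r ^ 3 < 0.1575 := by
  have : r ^ 3 < 0.54 ^ 3 := pow_lt_pow_left₀ h1 h0.le (by norm_num)
  linarith

/-- the inequality between `u` and `y`. -/
lemma aux_uy (u y : ℝ) (hu : 0 < u) (hu1 : u < 0.1575) (hy : 0 ≤ y) (hy2 : y ^ 2 ≤ 0.0304) :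
    (27 - 18 * u) * y ^ 2 ≤ (1 - 2 * u) ^ 2 + 2 * (1 - 2 * u) * (1 + u) * y := by
  have hy3 : y ≤ 0.17436 := by nlinarith
  have h1 : (27 - 18 * u) * y ^ 2 ≤ (27 - 18 * u) * (0.17436 * y) := by
    apply mul_le_mul_of_nonneg_left _ (by linarith)
    nlinarith
  have h2 : (27 - 18 * u) * 0.17436 - 2 * (1 - 2 * u) * (1 + u) ≤ (1 - 2 * u) ^ 2 / 0.17436 := by
    rw [le_div_iff₀ (by norm_num)]
    nlinarith
  have h3 := mul_le_mul_of_nonneg_right h2 hy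
  have h4 : (1 - 2 * u) ^ 2 / 0.17436 * y ≤ (1 - 2 * u) ^ 2 := by
    rw [div_mul_eq_mul_div, div_le_iff₀ (by norm_num)]
    exact mul_le_mul_of_nonneg_left hy3 (sq_nonneg _)
  nlinarith

lemma aux_y2 (r K T : ℝ) (h0 : 0 < r) (h1 : r < 0.54) (hK : 4.326 < K)
    (hT : T ^ 2 = 3 * r ^ 2 + 2 / r - K) :
    (r ^ 2 * T) ^ 2 ≤ 3 * r ^ 6 + 2 * r ^ 3 - 4.326 * r ^ 4 := by
  have e : (r ^ 2 * T) ^ 2 = 3 * r ^ 6 + 2 * r ^ 3 - K * r ^ 4 := by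
    rw [mul_pow, hT]; field_simp
  rw [e]
  have : 0 < r ^ 4 := by positivity
  nlinarith

lemma aux_phi (r T : ℝ) (h0 : 0 < r) :
    (11/12) / r ^ 7 - (10/3) / r ^ 4 - (29/6) / r + 4 * r ^ 2 - (3/4) * r ^ 5
    - 2 * (1 / r ^ 5 - 2 / r ^ 2) * T - (2 + 2 / r ^ 3) * T ^ 2 =
    (11/12 - 10/3 * r^3 - 29/6 * r^6 + 4 * r^9 - 3/4 * r^12
      - 2 * (1 - 2 * r^3) * (r ^ 2 * T) - 2 * (1 + r^3) * (r ^ 2 * T) ^ 2) / r ^ 7 := by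
  field_simp
  ring

/-- the mixed term -/
lemma aux_mixed (r K T p t a b : ℝ) (h0 : 0 < r) (h1 : r < 0.54) (hK : 4.326 < K)
    (hT : T ^ 2 = 3 * r ^ 2 + 2 / r - K) (hT0 : 0 ≤ T) (hpt : p ^ 2 + t ^ 2 = 1)
    (hs : a ^ 2 + b ^ 2 ≤ T ^ 2 - 3 * r ^ 2 * t ^ 2) :
    -((1 - 2 * r^3) * T + 3 * r^4 * (1 + r^3) * t^2) ≤
      a * (t * (1 - 2 * r^3 - 9 * p^2 * r^3))
        + b * (- p * (1 - 2 * r^3 + 9 * t^2 * r^3 - 3 * r^6)) := by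
  have hu := aux_u r h0 h1
  have hu0 : 0 < r ^ 3 := by positivity
  have hy := aux_uy (r^3) (r^2 * T) hu0 hu (by positivity)
    ((aux_y2 r K T h0 h1 hK hT).trans (aux_y_max r h0 h1))
  set u := r ^ 3 with hu_def
  set c := t * (1 - 2 * u - 9 * p^2 * u) with hc
  have e6 : r ^ 6 = u ^ 2 := by rw [hu_def]; ring
  rw [e6]
  set d := - p * (1 - 2 * u + 9 * t^2 * u - 3 * u ^ 2) with hd
  have hcd : c ^ 2 + d ^ 2 ≤ (1 - 2 * u) ^ 2 + p^2 * t^2 * (81 * u^2 - 54 * u^3) := by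
    have e : c ^ 2 + d ^ 2 = (1 - 2 * u) ^ 2 + p^2 * t^2 * (81 * u^2 - 54 * u^3)
        + p^2 * (-6 * u^2 + 12 * u^3 + 9 * u^4) := by
      have : t ^ 2 = 1 - p ^ 2 := by linarith
      have e1 : c ^ 2 = t ^ 2 * (1 - 2 * u - 9 * p^2 * u) ^ 2 := by rw [hc]; ring
      have e2 : d ^ 2 = p ^ 2 * (1 - 2 * u + 9 * t^2 * u - 3 * u ^ 2) ^ 2 := by rw [hd]; ring
      rw [e1, e2, this]; ring
    have : 0 ≤ p ^ 2 * u ^ 2 * (6 - 12 * u - 9 * u ^ 2) := by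
      apply mul_nonneg (by positivity); nlinarith
    linarith
  have hN : 0 ≤ (1 - 2 * u) * T + 3 * r^4 * (1 + u) * t^2 := by
    have : 0 ≤ 1 - 2 * u := by linarith
    positivity
  have hcs : (a * c + b * d) ^ 2 ≤ (a^2 + b^2) * (c^2 + d^2) := by
    nlinarith [sq_nonneg (a * d - b * c)]
  have hp1 : p ^ 2 ≤ 1 := by nlinarith [sq_nonneg t]
  have hF : 0 ≤ 81 * u^2 - 54 * u^3 := by
    have : 81 * u^2 - 54 * u^3 = u ^ 2 * (81 - 54 * u) := by ring
    rw [this]; apply mul_nonneg (by positivity); linarith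
  have h2 : (a^2 + b^2) * (c^2 + d^2) ≤ (T ^ 2 - 3 * r ^ 2 * t ^ 2) *
      ((1 - 2 * u) ^ 2 + t^2 * (81 * u^2 - 54 * u^3)) := by
    apply mul_le_mul hs _ (by positivity) (le_trans (by positivity) hs)
    have := mul_le_mul_of_nonneg_right hp1 (mul_nonneg (sq_nonneg t) hF)
    linarith
  have h3 : (T ^ 2 - 3 * r ^ 2 * t ^ 2) * ((1 - 2 * u) ^ 2 + t^2 * (81 * u^2 - 54 * u^3))
      ≤ ((1 - 2 * u) * T + 3 * r^4 * (1 + u) * t^2) ^ 2 := by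
    have k1 := mul_le_mul_of_nonneg_left hy (show 0 ≤ 3 * r^2 * t^2 by positivity)
    have k2 : 0 ≤ 3 * r ^ 2 * t ^ 2 * (t^2 * (81 * u^2 - 54 * u^3)) :=
      mul_nonneg (by positivity) (mul_nonneg (by positivity) hF)
    have k3 : 0 ≤ (3 * r^4 * (1 + u) * t^2) ^ 2 := sq_nonneg _
    have e1 : 3 * r^2 * t^2 * ((27 - 18 * u) * (r ^ 2 * T) ^ 2)
        = T ^ 2 * (t^2 * (81 * u^2 - 54 * u^3)) := by rw [hu_def]; ring
    rw [e1] at k1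
    linarith
  exact (abs_le.1 (abs_le_of_sq_le_sq (hcs.trans (h2.trans h3)) hN)).1

lemma aux_quad (r p t a b : ℝ) (h0 : 0 < r) (hpt : p ^ 2 + t ^ 2 = 1) :
    -(2 * (1 + r^3)) * (a^2 + b^2) ≤
      (1 - 3 * p^2 - 2 * r^3) * a^2 - 6 * p * t * a * b + (1 - 3 * t^2 + r^3) * b^2 := by
  have hu0 : 0 < r ^ 3 := by positivity
  have e : (a^2 + b^2) - (p * a + t * b)^2 = (p * b - t * a) ^ 2 := by
    have : t ^ 2 = 1 - p ^ 2 := by linarith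
    linear_combination (-(a^2 + b^2)) * hpt
  nlinarith [sq_nonneg (p * b - t * a), mul_nonneg hu0.le (sq_nonneg a), mul_nonneg hu0.le (sq_nonneg b)]

lemma aux_expand (r p t a b : ℝ) (h0 : 0 < r) (hpt : p ^ 2 + t ^ 2 = 1) :
    r ^ 7 * (1 / r ^ 5 * ((-2 * r^5 + r^2 - 3 * (r*p)^2) * (r * t / r^3 + a)^2
      + 2 * (-3 * (r*p) * (r*t)) * (r * t / r^3 + a) * (3 * (r*p) - r * p / r^3 + b)
      + (r^5 + r^2 - 3 * (r*t)^2) * (3 * (r*p) - r * p / r^3 + b)^2)) =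
    (11/12 - 10/3 * r^3 - 29/6 * r^6 + 4 * r^9 - 3/4 * r^12)
    + 1/12 * (18 * r^3 * p^2 - (1 + 8 * r^3 - 3 * r^6))^2
    + 2 * r^2 * (a * (t * (1 - 2 * r^3 - 9 * p^2 * r^3))
        + b * (- p * (1 - 2 * r^3 + 9 * t^2 * r^3 - 3 * r^6)))
    + r^4 * ((1 - 3 * p^2 - 2 * r^3) * a^2 - 6 * p * t * a * b + (1 - 3 * t^2 + r^3) * b^2) := by
  have ht : t ^ 2 = 1 - p ^ 2 := by linarith
  have e1 : r * t / r^3 = t / r^2 := by field_simp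
  have e2 : 3 * (r*p) - r * p / r^3 = p * (3 * r^3 - 1) / r^2 := by field_simp
  have e3 : t / r^2 + a = (t + a * r^2) / r^2 := by field_simp
  have e4 : p * (3 * r^3 - 1) / r^2 + b = (p * (3 * r^3 - 1) + b * r^2) / r^2 := by field_simp
  have ht3 : t ^ 3 = t * (1 - p ^ 2) := by rw [← ht]; ring
  have ht4 : t ^ 4 = (1 - p ^ 2) ^ 2 := by rw [← ht]; ring
  rw [e1, e2, e3, e4]
  field_simp
  ring_nf
  simp only [ht]
  ring

/-- Step 1 estimate: for `q ∈ 𝔯` with `|q| < 0.54` and `|s|² ≤ 3q₁² + 2/|q| - 3^{4/3}`,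
the tangential Hessian quadratic form is at least `φ(|q|)`; moreover `φ(r) > 0` on
`(0, 0.54)`. -/
theorem step_one_estimate :
    (∀ q ∈ HillRegion, nrm q < 0.54 →
      ∀ s : Fin 2 → ℝ,
        s 0 ^ 2 + s 1 ^ 2 ≤ 3 * q.1 ^ 2 + 2 / nrm q - (3:ℝ) ^ ((4:ℝ)/3) →
        φLB (nrm q) ≤ (w q + s) ⬝ᵥ (Hmat q).mulVec (w q + s)) ∧
    (∀ r ∈ Set.Ioo (0:ℝ) 0.54, 0 < φLB r) := by
  constructor
  · intro q hq hr s hs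
    have hn0 : 0 ≤ nrm q := Real.sqrt_nonneg _
    have hr0 : 0 < nrm q := by
      rcases hn0.lt_or_eq with h | h
      · exact h
      · exfalso
        have h1 := hq.1
        have h2 : q.1 ^ 2 + q.2 ^ 2 = 0 :=
          (Real.sqrt_eq_zero (by positivity)).1 h.symm
        have h3 : q.1 ^ 2 = 0 := by nlinarith [sq_nonneg q.1, sq_nonneg q.2]
        rw [← h, h3] at h1
        have := aux_K_lo
        norm_num at h1
        linarith
    have hsq : nrm q ^ 2 = q.1 ^ 2 + q.2 ^ 2 := Real.sq_sqrt (by positivity)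
    obtain ⟨x, z⟩ := q
    simp only [Hmat, w] at *
    generalize nrm (x, z) = r at *
    obtain ⟨p, rfl⟩ : ∃ p, x = r * p := ⟨x / r, by field_simp⟩
    obtain ⟨t, rfl⟩ : ∃ t, z = r * t := ⟨z / r, by field_simp⟩
    have hpt : p ^ 2 + t ^ 2 = 1 := by
      have : r ^ 2 * (p ^ 2 + t ^ 2) = r ^ 2 * 1 := by linarith
      exact mul_left_cancel₀ (by positivity) this
    have hK1 := aux_K_lo
    have hK2 := aux_K_hi
    have hrad := aux_rad r _ hr0 hr hK2
    have hT := Real.sq_sqrt hrad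
    have hT0 := Real.sqrt_nonneg (3 * r ^ 2 + 2 / r - (3:ℝ) ^ ((4:ℝ)/3))
    have hphi := aux_phi r (√(3 * r ^ 2 + 2 / r - (3:ℝ) ^ ((4:ℝ)/3))) hr0
    unfold φLB
    rw [hT] at hphi
    rw [hphi, div_le_iff₀ (by positivity)]
    set T := √(3 * r ^ 2 + 2 / r - (3:ℝ) ^ ((4:ℝ)/3)) with hTdef
    have hs' : s 0 ^ 2 + s 1 ^ 2 ≤ T ^ 2 - 3 * r ^ 2 * t ^ 2 := by
      rw [hT]
      have : p ^ 2 = 1 - t ^ 2 := by linarith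
      have e : (r * p) ^ 2 = r ^ 2 - r ^ 2 * t ^ 2 := by rw [mul_pow, this]; ring
      rw [e] at hs; linarith
    have hM := aux_mixed r _ T p t (s 0) (s 1) hr0 hr hK1 hT hT0 hpt hs'
    have hQ := aux_quad r p t (s 0) (s 1) hr0 hpt
    have hE := aux_expand r p t (s 0) (s 1) hr0 hpt
    have hgoal : (![r * t / r ^ 3, 3 * (r * p) - r * p / r ^ 3] + s) ⬝ᵥ
        ((1 / r ^ 5) • !![-2 * r ^ 5 + r ^ 2 - 3 * (r * p) ^ 2, -3 * (r * p) * (r * t);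
          -3 * (r * p) * (r * t), r ^ 5 + r ^ 2 - 3 * (r * t) ^ 2]).mulVec
        (![r * t / r ^ 3, 3 * (r * p) - r * p / r ^ 3] + s) =
        (1 / r ^ 5 * ((-2 * r^5 + r^2 - 3 * (r*p)^2) * (r * t / r^3 + s 0)^2
      + 2 * (-3 * (r*p) * (r*t)) * (r * t / r^3 + s 0) * (3 * (r*p) - r * p / r^3 + s 1)
      + (r^5 + r^2 - 3 * (r*t)^2) * (3 * (r*p) - r * p / r^3 + s 1)^2)) := by
      rw [Matrix.smul_mulVec, dotProduct_smul, smul_eq_mul]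
      congr 1
      simp only [dotProduct, Matrix.mulVec, Matrix.of_apply,
        Fin.sum_univ_two, Pi.add_apply, Matrix.cons_val_zero, Matrix.cons_val_one]
      ring
    rw [hgoal, mul_comm _ (r ^ 7), hE]
    have k1 := mul_le_mul_of_nonneg_left hM (show 0 ≤ 2 * r^2 by positivity)
    have k2 := mul_le_mul_of_nonneg_left hQ (show 0 ≤ r^4 by positivity)
    have k3 := mul_le_mul_of_nonneg_left hs' (show 0 ≤ r^4 * (2 * (1 + r^3)) by positivity)
    have k4 := sq_nonneg (18 * r^3 * p^2 - (1 + 8 * r^3 - 3 * r^6))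
    linarith
  · rintro r ⟨h0, h1⟩
    have hK1 := aux_K_lo
    have hrad := aux_rad r _ h0 h1 aux_K_hi
    have hT := Real.sq_sqrt hrad
    have hphi := aux_phi r (√(3 * r ^ 2 + 2 / r - (3:ℝ) ^ ((4:ℝ)/3))) h0
    unfold φLB
    rw [hT] at hphi
    rw [hphi]
    apply div_pos _ (by positivity)
    set T := √(3 * r ^ 2 + 2 / r - (3:ℝ) ^ ((4:ℝ)/3)) with hTdef
    have hy := aux_y2 r _ T h0 h1 hK1 hT
    have hp := aux_poly r h0 h1
    have hu := aux_u r h0 h1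
    have hu0 : 0 < r ^ 3 := by positivity
    have hyy : 2 * (r ^ 2 * T) ≤ (3 * r ^ 6 + 2 * r ^ 3 - 4.326 * r ^ 4) / 0.15 + 0.15 := by
      have : 2 * (r ^ 2 * T) ≤ (r ^ 2 * T) ^ 2 / 0.15 + 0.15 := by
        have h5 := sq_nonneg (r ^ 2 * T - 0.15)
        generalize r ^ 2 * T = y at h5 ⊢
        have e : y ^ 2 / 0.15 + 0.15 - 2 * y = (y - 0.15) ^ 2 / 0.15 := by
          norm_num; ring
        have h6 : 0 ≤ (y - 0.15) ^ 2 / 0.15 := by positivity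
        linarith only [e, h6]
      have h := div_le_div_of_nonneg_right hy (show (0:ℝ) ≤ 0.15 by norm_num)
      linarith
    have k1 := mul_le_mul_of_nonneg_left hyy (show 0 ≤ 1 - 2 * r^3 by linarith)
    have k2 := mul_le_mul_of_nonneg_left hy (show 0 ≤ 2 * (1 + r^3) by linarith)
    linarith

end
end

section
/- For every q ∈ 𝔯⁺ with |q| ≥ 0.54, the smooth 2π-periodic function f_q : ℝ → ℝ has exactly two critical points in [0, 2π); one of them is a local minimum point of f_q and the other is a local maximum point of f_q, and these are respectively the unique local minimum and the unique local maximum of f_q viewed as a function on ℝ/2πℤ. -/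
open Matrix

noncomputable section

/-- The first quadrant part `𝔯⁺` of Hill's region. -/
def HillRegionPlus : Set (ℝ × ℝ) := {q ∈ HillRegion | 0 ≤ q.1 ∧ 0 ≤ q.2}

/-- The radius `ρ(q) = √(3q₁² + 2/|q| - 3^{4/3})`. -/
def ρ (q : ℝ × ℝ) : ℝ := Real.sqrt (3 * q.1 ^ 2 + 2 / nrm q - (3:ℝ) ^ ((4:ℝ)/3))

/-- The function `f_q(α) = (w(q)+s)ᵀ 𝓗(q) (w(q)+s)` where
`s = ρ(q)·(cos(θ+α), sin(θ+α))` and `θ` is the polar angle of `q`. -/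
def fq (q : ℝ × ℝ) (θ : ℝ) (α : ℝ) : ℝ :=
  (w q + ρ q • ![Real.cos (θ + α), Real.sin (θ + α)]) ⬝ᵥ
    (Hmat q).mulVec (w q + ρ q • ![Real.cos (θ + α), Real.sin (θ + α)])

lemma aux_ineq (u v k : ℝ) (hv : v ^ 3 = 3) (hv0 : 0 < v) (huv : v < u) (hu : 2 * u < 3 * v)
    (hk1 : k ≤ 1) (hρ : 0 < 3 * k + 2 * u ^ 3 - 3 * v * u ^ 2) :
    0 < 9 * k * (1 - k) * (1 - 3 * u ^ 3) ^ 2 + (3 * k + 2 * u ^ 3 - u ^ 6) ^ 2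
      - 9 * (3 * k + 2 * u ^ 3 - 3 * v * u ^ 2) * (1 - 2 * u ^ 3 + 4 * u ^ 3 * k + u ^ 6) := by
  have hu0 : 0 < u := hv0.trans huv
  obtain ⟨k0, hk0⟩ : ∃ k0, k0 = (3 * v * u ^ 2 - 2 * u ^ 3) / 3 := ⟨_, rfl⟩
  have h1 : 0 ≤ k0 := by
    have : 0 ≤ u ^ 2 * (3 * v - 2 * u) := mul_nonneg (sq_nonneg _) (by linarith)
    rw [hk0]; linarith
  have h2 : 0 < 1 - k0 := by
    have : 0 < (u - v) ^ 2 * (2 * u + v) := mul_pos (pow_pos (by linarith) 2) (by linarith)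
    rw [hk0]; linarith
  have h3 : 0 < k - k0 := by rw [hk0]; linarith
  have hD : 0 < u ^ 6 - 24 * u ^ 3 - 18 + 27 * v * u ^ 2 := by
    have h : 0 < (u - v) ^ 3 * (u ^ 3 + 3 * u ^ 2 * v + 6 * u * v ^ 2 + 2 * v ^ 3) :=
      mul_pos (pow_pos (by linarith) 3) (by positivity)
    have e : u ^ 6 - 24 * u ^ 3 - 18 + 27 * v * u ^ 2
       = (u - v) ^ 3 * (u ^ 3 + 3 * u ^ 2 * v + 6 * u * v ^ 2 + 2 * v ^ 3) := by
      linear_combination (8 * u ^ 3 - 9 * v * u ^ 2 + 2 * v ^ 3 + 6) * hv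
    rw [e]; exact h
  have e0 : 3 * v * u ^ 2 = 3 * k0 + 2 * u ^ 3 := by rw [hk0]; ring
  have hG1 : 0 < (1 + u ^ 3) ^ 2 * (u ^ 6 - 24 * u ^ 3 - 18 + 27 * v * u ^ 2) :=
    mul_pos (by positivity) hD
  have hG0 : 0 ≤ 9 * k0 * (1 - k0) * (1 - 3 * u ^ 3) ^ 2 + (3 * k0 + 2 * u ^ 3 - u ^ 6) ^ 2 := by
    have := mul_nonneg (mul_nonneg h1 h2.le) (sq_nonneg (1 - 3 * u ^ 3))
    nlinarith [sq_nonneg (3 * k0 + 2 * u ^ 3 - u ^ 6)]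
  have hk : 0 ≤ 1 - k := by linarith
  have a1 := mul_nonneg hG0 hk
  have a2 := mul_pos hG1 h3
  have a3 : 0 ≤ (81 * u ^ 6 + 54 * u ^ 3) * ((1 - k) * (k - k0) * (1 - k0)) :=
    mul_nonneg (by positivity) (mul_nonneg (mul_nonneg hk h3.le) h2.le)
  refine pos_of_mul_pos_left ?_ h2.le
  have e1 : 27 * v * u ^ 2 = 9 * (3 * k0 + 2 * u ^ 3) := by rw [← e0]; ring
  rw [e1] at a2
  rw [e0]
  nlinarith [a1, a2, a3]

def GG (R A B y : ℝ) : ℝ := -R * Real.sin y - 2 * A * Real.sin (2 * y) + 2 * B * Real.cos (2 * y)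

lemma GG_continuous (R A B : ℝ) : Continuous (GG R A B) := by unfold GG; fun_prop

lemma GG_anti (R A B : ℝ) (hR : 0 < R) (h : 16 * (A ^ 2 + B ^ 2) < R ^ 2) :
    StrictAntiOn (fun y => GG R A B y / Real.cos y) (Set.Ioo (-(Real.pi / 2)) (Real.pi / 2)) := by
  have hc : ∀ y ∈ Set.Ioo (-(Real.pi / 2)) (Real.pi / 2), 0 < Real.cos y :=
    fun y hy => Real.cos_pos_of_mem_Ioo hy
  apply strictAntiOn_of_deriv_neg (convex_Ioo _ _)
  · exact (GG_continuous R A B).continuousOn.div Real.continuous_cos.continuousOn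
      (fun y hy => (hc y hy).ne')
  · intro y hy
    rw [interior_Ioo] at hy
    have hcy := hc y hy
    have hd : HasDerivAt (GG R A B) (-R * Real.cos y - 2 * A * (Real.cos (2 * y) * 2)
        + 2 * B * (-Real.sin (2 * y) * 2)) y := by
      have h2 : HasDerivAt (fun y : ℝ => 2 * y) 2 y := by
        simpa using (hasDerivAt_id y).const_mul (2:ℝ)
      exact (((Real.hasDerivAt_sin y).const_mul (-R)).sub
        ((h2.sin).const_mul (2 * A))).add ((h2.cos).const_mul (2 * B))
    have hq := hd.div (Real.hasDerivAt_cos y) hcy.ne'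
    have hq' : deriv (fun y => GG R A B y / Real.cos y) y = _ := hq.deriv
    rw [hq']
    apply div_neg_of_neg_of_pos _ (by positivity)
    unfold GG
    rw [Real.sin_two_mul, Real.cos_two_mul]
    have hs := Real.sin_sq_add_cos_sq y
    generalize Real.sin y = s at *
    generalize Real.cos y = c at *
    have hc1 : c ^ 2 ≤ 1 := by nlinarith [sq_nonneg s]
    have hs2 : s ^ 2 = 1 - c ^ 2 := by linarith
    have key : -R < 4 * A * c ^ 3 + 2 * B * (s * (2 * c ^ 2 + 1)) := by
      refine (abs_lt_of_sq_lt_sq ?_ hR.le |> abs_lt.mp).1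
      have cs : (4 * A * c ^ 3 + 2 * B * (s * (2 * c ^ 2 + 1))) ^ 2 ≤
          (A ^ 2 + B ^ 2) * (16 * c ^ 6 + 4 * s ^ 2 * (2 * c ^ 2 + 1) ^ 2) := by
        nlinarith [sq_nonneg (A * (2 * (s * (2 * c ^ 2 + 1))) - B * (4 * c ^ 3))]
      have e : 16 * c ^ 6 + 4 * s ^ 2 * (2 * c ^ 2 + 1) ^ 2 = 4 + 12 * c ^ 2 := by
        rw [hs2]; ring
      rw [e] at cs
      have : (A ^ 2 + B ^ 2) * (4 + 12 * c ^ 2) ≤ (A ^ 2 + B ^ 2) * 16 :=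
        mul_le_mul_of_nonneg_left (by linarith) (by positivity)
      linarith
    have e : (-R * c - 2 * A * ((2 * c ^ 2 - 1) * 2) + 2 * B * (-(2 * s * c) * 2)) * c -
      (-R * s - 2 * A * (2 * s * c) + 2 * B * (2 * c ^ 2 - 1)) * -s
      = -R - (4 * A * c ^ 3 + 2 * B * (s * (2 * c ^ 2 + 1))) := by
      linear_combination (-R - 4 * A * c) * hs
    rw [e]; linarith

lemma GG_half (R A B : ℝ) (hR : 0 < R) (h : 16 * (A ^ 2 + B ^ 2) < R ^ 2) :
    ∃ y ∈ Set.Ioo (-(Real.pi / 2)) (Real.pi / 2), GG R A B y = 0 ∧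
      (∀ x, -(Real.pi / 2) ≤ x → x < y → 0 < GG R A B x) ∧
      (∀ x, y < x → x ≤ Real.pi / 2 → GG R A B x < 0) := by
  have hB : |2 * B| < R := by
    apply abs_lt_of_sq_lt_sq _ hR.le
    nlinarith [sq_nonneg A, sq_nonneg B]
  obtain ⟨hB1, hB2⟩ := abs_lt.mp hB
  have hl : 0 < GG R A B (-(Real.pi / 2)) := by
    have : GG R A B (-(Real.pi / 2)) = R - 2 * B := by
      unfold GG
      rw [show 2 * (-(Real.pi / 2)) = -Real.pi by ring]
      simp; ring
    linarith
  have hr : GG R A B (Real.pi / 2) < 0 := by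
    have : GG R A B (Real.pi / 2) = -R - 2 * B := by
      unfold GG
      rw [show 2 * (Real.pi / 2) = Real.pi by ring]
      simp; ring
    linarith
  have hpi := Real.pi_pos
  obtain ⟨y, hy, hy0⟩ := intermediate_value_Ioo' (by linarith : -(Real.pi / 2) ≤ Real.pi / 2)
    (GG_continuous R A B).continuousOn ⟨hr, hl⟩
  have anti := GG_anti R A B hR h
  refine ⟨y, hy, hy0, ?_, ?_⟩
  · intro x hx hxy
    rcases hx.eq_or_lt with rfl | hx
    · exact hl
    have hxm : x ∈ Set.Ioo (-(Real.pi / 2)) (Real.pi / 2) := ⟨hx, hxy.trans hy.2⟩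
    have := anti hxm hy hxy
    simp only [hy0, zero_div] at this
    exact (div_pos_iff_of_pos_right (Real.cos_pos_of_mem_Ioo hxm)).mp this
  · intro x hxy hx
    rcases hx.eq_or_lt with rfl | hx
    · exact hr
    have hxm : x ∈ Set.Ioo (-(Real.pi / 2)) (Real.pi / 2) := ⟨hy.1.trans hxy, hx⟩
    have := anti hy hxm hxy
    simp only [hy0, zero_div] at this
    by_contra hcon
    exact absurd (div_nonneg (not_lt.mp hcon) (Real.cos_pos_of_mem_Ioo hxm).le) (not_le.mpr this)

lemma GG_full (R A B : ℝ) (hR : 0 < R) (h : 16 * (A ^ 2 + B ^ 2) < R ^ 2) :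
    ∃ y1 y2, y1 < y2 ∧ y2 < y1 + 2 * Real.pi ∧ GG R A B y1 = 0 ∧ GG R A B y2 = 0 ∧
      (∀ x ∈ Set.Ioo y1 y2, GG R A B x < 0) ∧
      (∀ x ∈ Set.Ioo y2 (y1 + 2 * Real.pi), 0 < GG R A B x) := by
  obtain ⟨y, hy, hy0, hyl, hyr⟩ := GG_half R A B hR h
  obtain ⟨z, hz, hz0, hzl, hzr⟩ := GG_half R (-A) (-B) hR (by simpa using h)
  have hpi := Real.pi_pos
  have e1 : ∀ x, GG R A B x = - GG R (-A) (-B) (x - Real.pi) := by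
    intro x
    unfold GG
    rw [show 2 * (x - Real.pi) = 2 * x - 2 * Real.pi by ring, Real.sin_sub_pi,
      Real.sin_sub_two_pi, Real.cos_sub_two_pi]
    ring
  have e2 : ∀ x, GG R A B x = GG R A B (x - 2 * Real.pi) := by
    intro x
    unfold GG
    rw [show 2 * (x - 2 * Real.pi) = 2 * x - 2 * Real.pi - 2 * Real.pi by ring,
      Real.sin_sub_two_pi, Real.sin_sub_two_pi, Real.sin_sub_two_pi, Real.cos_sub_two_pi,
      Real.cos_sub_two_pi]
  refine ⟨y, z + Real.pi, by linarith [hy.2, hz.1], by linarith [hy.1, hz.2], hy0, ?_, ?_, ?_⟩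
  · rw [e1]; simp [hz0]
  · rintro x ⟨h1, h2⟩
    rcases le_total x (Real.pi / 2) with h3 | h3
    · exact hyr x h1 h3
    · rw [e1]; have := hzl (x - Real.pi) (by linarith) (by linarith); linarith
  · rintro x ⟨h1, h2⟩
    rcases le_total x (3 * Real.pi / 2) with h3 | h3
    · rw [e1]; have := hzr (x - Real.pi) (by linarith) (by linarith); linarith
    · rw [e2]; exact hyl _ (by linarith) (by linarith)

lemma not_both (f g : ℝ → ℝ) (hf : ∀ x, HasDerivAt f (g x) x) (x b : ℝ) (hb : x < b)
    (hg : ∀ y ∈ Set.Ioo x b, g y ≠ 0) (h1 : IsLocalMin f x) (h2 : IsLocalMax f x) : False := by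
  have h : f =ᶠ[nhds x] fun _ => f x := by
    filter_upwards [h1, h2] with y a b using le_antisymm b a
  have h3 := h.deriv
  have h4 : ∀ᶠ y in nhdsWithin x (Set.Ioi x), y ∈ Set.Ioo x b := Ioo_mem_nhdsGT hb
  obtain ⟨y, hy, hy'⟩ := ((h3.filter_mono nhdsWithin_le_nhds).and h4).exists
  rw [(hf y).deriv] at hy
  simp at hy
  exact hg y hy' hy

lemma core_s12 (f g : ℝ → ℝ) (hf : ∀ x, HasDerivAt f (g x) x)
    (hgp : ∀ x, ∀ n : ℤ, g (x + n * (2 * Real.pi)) = g x) (x1 x2 : ℝ) (h12 : x1 < x2)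
    (h21 : x2 < x1 + 2 * Real.pi) (g1 : g x1 = 0) (g2 : g x2 = 0)
    (hn : ∀ x ∈ Set.Ioo x1 x2, g x < 0) (hp : ∀ x ∈ Set.Ioo x2 (x1 + 2 * Real.pi), 0 < g x) :
    ∃ a b : ℝ, a ∈ Set.Ico (0:ℝ) (2 * Real.pi) ∧ b ∈ Set.Ico (0:ℝ) (2 * Real.pi) ∧
      a ≠ b ∧
      {α ∈ Set.Ico (0:ℝ) (2 * Real.pi) | deriv f α = 0} = {a, b} ∧
      IsLocalMin f a ∧ IsLocalMax f b ∧
      (∀ α : ℝ, IsLocalMin f α → ∃ n : ℤ, α = a + n * (2 * Real.pi)) ∧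
      (∀ α : ℝ, IsLocalMax f α → ∃ n : ℤ, α = b + n * (2 * Real.pi)) := by
  have hpi := Real.two_pi_pos
  set T := 2 * Real.pi with hT
  have hfc : Continuous f := continuous_iff_continuousAt.mpr fun x => (hf x).continuousAt
  have hfd : Differentiable ℝ f := fun x => (hf x).differentiableAt
  have hderiv : ∀ x, deriv f x = g x := fun x => (hf x).deriv
  have red : ∀ (x y : ℝ), ∃ n : ℤ, y ≤ x + n * T ∧ x + n * T < y + T := by
    intro x y
    obtain ⟨n, hn, -⟩ := existsUnique_add_zsmul_mem_Ico hpi x y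
    simp only [zsmul_eq_mul] at hn
    exact ⟨n, hn.1, hn.2⟩
  have hn' : ∀ n : ℤ, ∀ x ∈ Set.Ioo (x1 + n * T) (x2 + n * T), g x < 0 := by
    intro n x hx
    have := hgp (x - n * T) n
    rw [sub_add_cancel] at this
    rw [this]; exact hn _ ⟨by linarith [hx.1], by linarith [hx.2]⟩
  have hp' : ∀ n : ℤ, ∀ x ∈ Set.Ioo (x2 + n * T) (x1 + n * T + T), 0 < g x := by
    intro n x hx
    have := hgp (x - n * T) n
    rw [sub_add_cancel] at this
    rw [this]; exact hp _ ⟨by linarith [hx.1], by linarith [hx.2]⟩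
  have max1 : ∀ n : ℤ, IsLocalMax f (x1 + n * T) := by
    intro n
    apply isLocalMax_of_deriv_Ioo (a := x2 + n * T - T) (c := x2 + n * T) (by linarith)
      (by linarith) hfc.continuousAt hfd.differentiableOn hfd.differentiableOn
    · intro x hx
      rw [hderiv]
      refine (hp' (n - 1) x ⟨?_, ?_⟩).le
      · push_cast; linarith [hx.1]
      · push_cast; linarith [hx.2]
    · intro x hx
      rw [hderiv]
      exact (hn' n x hx).le
  have min2 : ∀ n : ℤ, IsLocalMin f (x2 + n * T) := by
    intro n
    apply isLocalMin_of_deriv_Ioo (a := x1 + n * T) (c := x1 + n * T + T) (by linarith)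
      (by linarith) hfc.continuousAt hfd.differentiableOn hfd.differentiableOn
    · intro x hx
      rw [hderiv]
      exact (hn' n x hx).le
    · intro x hx
      rw [hderiv]
      exact (hp' n x hx).le
  have crit : ∀ x, g x = 0 → (∃ n : ℤ, x = x1 + n * T) ∨ (∃ n : ℤ, x = x2 + n * T) := by
    intro x hx
    obtain ⟨n, ha, hb⟩ := red x x1
    have hx' := hgp x n
    rw [hx] at hx'
    rcases ha.eq_or_lt with h | h
    · left; exact ⟨-n, by push_cast; linarith⟩
    · right
      rcases lt_trichotomy (x + n * T) x2 with h' | h' | h'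
      · exact absurd hx' (hn _ ⟨h, h'⟩).ne
      · exact ⟨-n, by push_cast; linarith⟩
      · exact absurd hx' (hp _ ⟨h', hb⟩).ne'
  obtain ⟨nb, hb0, hb1⟩ := red x1 0
  obtain ⟨na, ha0, ha1⟩ := red x2 0
  rw [zero_add] at hb1 ha1
  have uniq : ∀ x y : ℝ, ∀ n : ℤ, 0 ≤ x → x < T → 0 ≤ y → y < T → y = x + n * T → y = x := by
    intro x y n a b c d e
    have h1 : (n : ℝ) < 1 := by by_contra hh; nlinarith
    have h2 : (-1 : ℝ) < n := by by_contra hh; nlinarith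
    have h3 : n = 0 := by
      have : n < 1 := by exact_mod_cast h1
      have : -1 < n := by exact_mod_cast h2
      omega
    rw [e, h3]; simp
  refine ⟨x2 + na * T, x1 + nb * T, ⟨ha0, ha1⟩, ⟨hb0, hb1⟩, ?_, ?_, min2 na, max1 nb, ?_, ?_⟩
  · intro he
    refine not_both f g hf _ (x2 + nb * T) (by linarith) (fun y hy => (hn' nb y hy).ne) ?_ (max1 nb)
    rw [← he]; exact min2 na
  · ext α
    simp only [Set.mem_ofPred_eq, Set.mem_insert_iff, Set.mem_singleton_iff, hderiv]
    constructor
    · rintro ⟨hα, h0⟩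
      rcases crit α h0 with ⟨n, e⟩ | ⟨n, e⟩
      · right
        exact uniq _ _ (n - nb) hb0 hb1 hα.1 hα.2 (by rw [e]; push_cast; ring)
      · left
        exact uniq _ _ (n - na) ha0 ha1 hα.1 hα.2 (by rw [e]; push_cast; ring)
    · rintro (rfl | rfl)
      · exact ⟨⟨ha0, ha1⟩, by rw [hgp, g2]⟩
      · exact ⟨⟨hb0, hb1⟩, by rw [hgp, g1]⟩
  · intro α hα
    have h0 : g α = 0 := by rw [← hderiv]; exact hα.deriv_eq_zero
    rcases crit α h0 with ⟨n, e⟩ | ⟨n, e⟩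
    · exfalso
      rw [e] at hα
      exact not_both f g hf _ (x2 + n * T) (by linarith) (fun y hy => (hn' n y hy).ne) hα (max1 n)
    · exact ⟨n - na, by rw [e]; push_cast; ring⟩
  · intro α hα
    have h0 : g α = 0 := by rw [← hderiv]; exact hα.deriv_eq_zero
    rcases crit α h0 with ⟨n, e⟩ | ⟨n, e⟩
    · exact ⟨n - nb, by rw [e]; push_cast; ring⟩
    · exfalso
      rw [e] at hα
      exact not_both f g hf _ (x1 + n * T + T) (by linarith) (fun y hy => (hp' n y hy).ne')
        (min2 n) hα

lemma trig_main (f : ℝ → ℝ) (θ K P Q A B : ℝ) (h : 16 * (A ^ 2 + B ^ 2) < P ^ 2 + Q ^ 2)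
    (hf : ∀ x, f x = K + P * Real.cos (θ + x) + Q * Real.sin (θ + x)
      + A * Real.cos (2 * (θ + x)) + B * Real.sin (2 * (θ + x))) :
    ∃ a b : ℝ, a ∈ Set.Ico (0:ℝ) (2 * Real.pi) ∧ b ∈ Set.Ico (0:ℝ) (2 * Real.pi) ∧
      a ≠ b ∧
      {α ∈ Set.Ico (0:ℝ) (2 * Real.pi) | deriv f α = 0} = {a, b} ∧
      IsLocalMin f a ∧ IsLocalMax f b ∧
      (∀ α : ℝ, IsLocalMin f α → ∃ n : ℤ, α = a + n * (2 * Real.pi)) ∧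
      (∀ α : ℝ, IsLocalMax f α → ∃ n : ℤ, α = b + n * (2 * Real.pi)) := by
  have hPQ : 0 < P ^ 2 + Q ^ 2 := lt_of_le_of_lt (by positivity) h
  obtain ⟨R, t, hR, hP, hQ⟩ : ∃ R t : ℝ, 0 < R ∧ P = R * Real.cos t ∧ Q = R * Real.sin t := by
    have hz : (⟨P, Q⟩ : ℂ) ≠ 0 := by
      intro hh
      have h1 := congrArg Complex.re hh
      have h2 := congrArg Complex.im hh
      simp at h1 h2
      simp [h1, h2] at hPQ
    refine ⟨‖(⟨P, Q⟩ : ℂ)‖, Complex.arg ⟨P, Q⟩, norm_pos_iff.mpr hz, ?_, ?_⟩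
    · rw [Complex.norm_mul_cos_arg]
    · rw [Complex.norm_mul_sin_arg]
  have hcs := Real.sin_sq_add_cos_sq t
  have hcs2 := Real.sin_sq_add_cos_sq (2 * t)
  have hR2 : P ^ 2 + Q ^ 2 = R ^ 2 := by
    rw [hP, hQ]; linear_combination R ^ 2 * hcs
  set A' := A * Real.cos (2 * t) + B * Real.sin (2 * t) with hA'
  set B' := B * Real.cos (2 * t) - A * Real.sin (2 * t) with hB'
  have hAB : A' ^ 2 + B' ^ 2 = A ^ 2 + B ^ 2 := by
    rw [hA', hB']; linear_combination (A ^ 2 + B ^ 2) * hcs2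
  obtain ⟨y1, y2, h12, h21, g1, g2, hn, hp⟩ := GG_full R A' B' hR (by rw [hAB, ← hR2]; exact h)
  have hfe : f = fun x => K + P * Real.cos (θ + x) + Q * Real.sin (θ + x)
      + A * Real.cos (2 * (θ + x)) + B * Real.sin (2 * (θ + x)) := funext hf
  refine core_s12 f (fun x => GG R A' B' (θ + x - t)) ?_ ?_ (y1 + t - θ) (y2 + t - θ)
    (by linarith) (by linarith) ?_ ?_ ?_ ?_
  · intro x
    rw [hfe]
    have d1 : HasDerivAt (fun x : ℝ => θ + x) 1 x := by
      simpa using (hasDerivAt_id x).const_add θ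
    have d2 : HasDerivAt (fun x : ℝ => 2 * (θ + x)) 2 x := by
      simpa using d1.const_mul (2:ℝ)
    have := ((((d1.cos.const_mul P).const_add K).add (d1.sin.const_mul Q)).add
      (d2.cos.const_mul A)).add (d2.sin.const_mul B)
    refine this.congr_deriv ?_
    unfold GG
    rw [show 2 * (θ + x - t) = 2 * (θ + x) - 2 * t by ring, Real.sin_sub, Real.sin_sub,
      Real.cos_sub, hA', hB', hP, hQ]
    linear_combination (2 * A * Real.sin (2 * (θ + x)) - 2 * B * Real.cos (2 * (θ + x))) * hcs2
  · intro x n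
    have e1 : θ + (x + n * (2 * Real.pi)) - t = (θ + x - t) + n * (2 * Real.pi) := by ring
    have e2 : 2 * ((θ + x - t) + n * (2 * Real.pi)) =
      2 * (θ + x - t) + ((2 * n : ℤ) : ℝ) * (2 * Real.pi) := by push_cast; ring
    simp only [GG]
    rw [e1, e2, Real.sin_add_int_mul_two_pi, Real.sin_add_int_mul_two_pi,
      Real.cos_add_int_mul_two_pi]
  · simpa [show θ + (y1 + t - θ) - t = y1 by ring] using g1
  · simpa [show θ + (y2 + t - θ) - t = y2 by ring] using g2
  · intro x hx
    exact hn _ ⟨by linarith [hx.1], by linarith [hx.2]⟩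
  · intro x hx
    exact hp _ ⟨by linarith [hx.1], by linarith [hx.2]⟩

set_option maxHeartbeats 1000000 in
/-- For `q ∈ 𝔯⁺` with `|q| ≥ 0.54` and polar angle `θ ∈ [0, π/2]`, the smooth
`2π`-periodic function `f_q` has exactly two critical points in `[0, 2π)`; one is a
local minimum point, the other a local maximum point, and these are respectively the
unique local minimum and the unique local maximum of `f_q` on the circle `ℝ/2πℤ`. -/
theorem unique_local_min_max (q : ℝ × ℝ) (hq : q ∈ HillRegionPlus)
    (hr : 0.54 ≤ nrm q) (θ : ℝ) (hθ : θ ∈ Set.Icc (0:ℝ) (Real.pi / 2))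
    (hq1 : q.1 = nrm q * Real.cos θ) (hq2 : q.2 = nrm q * Real.sin θ) :
    ∃ a b : ℝ, a ∈ Set.Ico (0:ℝ) (2 * Real.pi) ∧ b ∈ Set.Ico (0:ℝ) (2 * Real.pi) ∧
      a ≠ b ∧
      {α ∈ Set.Ico (0:ℝ) (2 * Real.pi) | deriv (fq q θ) α = 0} = {a, b} ∧
      IsLocalMin (fq q θ) a ∧ IsLocalMax (fq q θ) b ∧
      (∀ α : ℝ, IsLocalMin (fq q θ) α → ∃ n : ℤ, α = a + n * (2 * Real.pi)) ∧
      (∀ α : ℝ, IsLocalMax (fq q θ) α → ∃ n : ℤ, α = b + n * (2 * Real.pi)) := by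
  obtain ⟨⟨hH, hQ1, -⟩, -, -⟩ := hq
  obtain ⟨v, hv⟩ : ∃ v : ℝ, v = (3:ℝ) ^ ((1:ℝ)/3) := ⟨_, rfl⟩
  have hv0 : 0 < v := by rw [hv]; positivity
  have hv3 : v ^ 3 = 3 := by
    rw [hv, ← Real.rpow_natCast, ← Real.rpow_mul (by norm_num)]; norm_num
  have hC : (3:ℝ) ^ ((4:ℝ)/3) = 3 * v := by
    rw [hv, show (4:ℝ)/3 = 1 + 1/3 by norm_num, Real.rpow_add (by norm_num), Real.rpow_one]
  have hvi : (3:ℝ) ^ (-(1:ℝ)/3) = v⁻¹ := by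
    rw [hv, show -(1:ℝ)/3 = -(1/3) by norm_num, Real.rpow_neg (by norm_num)]
  rw [hC] at hH
  rw [hvi] at hQ1
  obtain ⟨r, hrr⟩ : ∃ r, r = nrm q := ⟨_, rfl⟩
  have hρd : ρ q = Real.sqrt (3 * q.1 ^ 2 + 2 / r - 3 * v) := by rw [ρ, hC, hrr]
  rw [← hrr] at hr hq1 hq2 hH
  have hr0 : 0 < r := lt_of_lt_of_le (by norm_num) hr
  obtain ⟨u, hu⟩ : ∃ u, u = 1 / r := ⟨_, rfl⟩
  have hu0 : 0 < u := by rw [hu]; positivity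
  have hru : r * u = 1 := by rw [hu]; field_simp
  have hcs := Real.sin_sq_add_cos_sq θ
  obtain ⟨c, hc⟩ : ∃ c, c = Real.cos θ := ⟨_, rfl⟩
  obtain ⟨s, hs⟩ : ∃ s, s = Real.sin θ := ⟨_, rfl⟩
  rw [← hc] at hq1
  rw [← hs] at hq2
  rw [← hc, ← hs] at hcs
  rw [← hu, hq1] at hH
  rw [hq1] at hQ1
  rw [hq1, show 2 / r = 2 * u by rw [hu]; ring] at hρd
  have hρ2pos : 0 < 3 * (r * c) ^ 2 + 2 * u - 3 * v := by linarith
  have hρpos : 0 < ρ q := by rw [hρd]; exact Real.sqrt_pos.mpr hρ2pos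
  have hρ2 : ρ q ^ 2 = 3 * (r * c) ^ 2 + 2 * u - 3 * v := by
    rw [hρd]; exact Real.sq_sqrt hρ2pos.le
  have huv : v < u := by
    have h1 : (r * c) ^ 2 < v⁻¹ ^ 2 := sq_lt_sq.mpr (by rwa [abs_of_pos (inv_pos.mpr hv0)])
    have h2 : 3 * v⁻¹ ^ 2 = v := by
      rw [← hv3]; field_simp
    linarith
  have hu15 : 2 * u < 3 * v := by
    have h1 : u ≤ 2 := by
      by_contra hh; nlinarith
    have h2 : (4:ℝ) / 3 < v := by
      by_contra hh
      push Not at hh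
      have : v ^ 3 ≤ (4 / 3) ^ 3 := pow_le_pow_left₀ hv0.le hh 3
      norm_num at this; linarith
    linarith
  have hk1 : c ^ 2 ≤ 1 := by nlinarith [sq_nonneg s]
  have hm : 0 < 3 * c ^ 2 + 2 * u ^ 3 - 3 * v * u ^ 2 := by
    have h1 : 3 * c ^ 2 + 2 * u ^ 3 - 3 * v * u ^ 2
      = u ^ 2 * (3 * (r * c) ^ 2 + 2 * u - 3 * v) := by
      linear_combination (-3 * c ^ 2 * (r * u + 1)) * hru
    rw [h1]; positivity
  have hG := aux_ineq u v (c ^ 2) hv3 hv0 huv hu15 hk1 hm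
  set p := s * u ^ 2 * (-2 + u ^ 3 - 9 * c ^ 2) with hp
  set d := c * (3 * r + 2 * u ^ 2 - u ^ 5 - 9 * s ^ 2 * u ^ 2) with hd
  set A := (-3 - 3 * u ^ 3 * (2 * c ^ 2 - 1)) / 2 with hA
  set B := -3 * c * s * u ^ 3 with hB
  have hs2 : s ^ 2 = 1 - c ^ 2 := by linarith
  have hineq : 4 * ρ q ^ 2 * (A ^ 2 + B ^ 2) < p ^ 2 + d ^ 2 := by
    have hsum : u ^ 2 * (p ^ 2 + d ^ 2) =
        9 * c ^ 2 * (1 - c ^ 2) * (1 - 3 * u ^ 3) ^ 2 + (3 * c ^ 2 + 2 * u ^ 3 - u ^ 6) ^ 2 := by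
      have e1 : u * p = s * (u ^ 3 * (-2 + u ^ 3 - 9 * c ^ 2)) := by rw [hp]; ring
      have e2 : u * d = c * (3 + 2 * u ^ 3 - u ^ 6 - 9 * (1 - c ^ 2) * u ^ 3) := by
        rw [hd, ← hs2]; linear_combination 3 * c * hru
      have e3 : u ^ 2 * (p ^ 2 + d ^ 2) = (u * p) ^ 2 + (u * d) ^ 2 := by ring
      rw [e3, e1, e2, mul_pow, hs2]; ring
    have hT : A ^ 2 + B ^ 2 = 9 / 4 * (1 - 2 * u ^ 3 + 4 * u ^ 3 * c ^ 2 + u ^ 6) := by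
      have : B ^ 2 = 9 * c ^ 2 * s ^ 2 * u ^ 6 := by rw [hB]; ring
      rw [this, hA, hs2]; ring
    have hRm : u ^ 2 * ρ q ^ 2 = 3 * c ^ 2 + 2 * u ^ 3 - 3 * v * u ^ 2 := by
      rw [hρ2]; linear_combination (3 * c ^ 2 * (r * u + 1)) * hru
    have : 0 < u ^ 2 * (p ^ 2 + d ^ 2 - 4 * ρ q ^ 2 * (A ^ 2 + B ^ 2)) := by
      have e : u ^ 2 * (p ^ 2 + d ^ 2 - 4 * ρ q ^ 2 * (A ^ 2 + B ^ 2))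
        = u ^ 2 * (p ^ 2 + d ^ 2) - 4 * (u ^ 2 * ρ q ^ 2) * (A ^ 2 + B ^ 2) := by ring
      rw [e, hsum, hRm, hT]; linarith
    have := pos_of_mul_pos_right this (by positivity)
    linarith
  clear_value p d A B
  obtain ⟨w1, hw1⟩ : ∃ w1, w1 = s * u ^ 2 := ⟨_, rfl⟩
  obtain ⟨w2, hw2⟩ : ∃ w2, w2 = c * (3 * r - u ^ 2) := ⟨_, rfl⟩
  obtain ⟨h11, hh11⟩ : ∃ h, h = -2 + u ^ 3 - 3 * c ^ 2 * u ^ 3 := ⟨_, rfl⟩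
  obtain ⟨h22, hh22⟩ : ∃ h, h = 1 + u ^ 3 - 3 * s ^ 2 * u ^ 3 := ⟨_, rfl⟩
  have hw : w q = ![w1, w2] := by
    rw [w, ← hrr, hq1, hq2, hw1, hw2, hu]
    congr 1
    · field_simp
    · congr 1
      field_simp
  have hHm : Hmat q = !![h11, B; B, h22] := by
    rw [Hmat, ← hrr, hq1, hq2, hh11, hh22, hB, hu]
    ext i j
    fin_cases i <;> fin_cases j <;> simp <;> field_simp
  have hpp : p = h11 * w1 + B * w2 := by
    rw [hp, hB, hh11, hw1, hw2]
    linear_combination (9 * c ^ 2 * s * u ^ 2) * hru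
  have hdd : d = B * w1 + h22 * w2 := by
    rw [hd, hB, hh22, hw1, hw2]
    linear_combination (-3 * c * u ^ 2 + 9 * c * s ^ 2 * u ^ 2) * hru
  have hAA : A = (h11 - h22) / 2 := by
    rw [hA, hh11, hh22, hs2]; ring
  refine trig_main (fq q θ) θ (h11 * w1 ^ 2 + 2 * B * w1 * w2 + h22 * w2 ^ 2
    + ρ q ^ 2 * (h11 + h22) / 2) (2 * ρ q * p) (2 * ρ q * d) (ρ q ^ 2 * A) (ρ q ^ 2 * B) ?_ ?_
  · have := mul_lt_mul_of_pos_left hineq (show 0 < 4 * ρ q ^ 2 by positivity)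
    have e1 : 16 * ((ρ q ^ 2 * A) ^ 2 + (ρ q ^ 2 * B) ^ 2)
      = 4 * ρ q ^ 2 * (4 * ρ q ^ 2 * (A ^ 2 + B ^ 2)) := by ring
    have e2 : (2 * ρ q * p) ^ 2 + (2 * ρ q * d) ^ 2 = 4 * ρ q ^ 2 * (p ^ 2 + d ^ 2) := by ring
    rw [e1, e2]; exact this
  · intro x
    have hx := Real.sin_sq_add_cos_sq (θ + x)
    rw [fq, hw, hHm, Real.cos_two_mul, Real.sin_two_mul, hpp, hdd, hAA]
    simp [Matrix.mulVec, dotProduct, Fin.sum_univ_two]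
    linear_combination (ρ q ^ 2 * h22) * hx

end
end

section
/- For every q ∈ 𝔯⁺ with |q| ≥ 0.54, one has f_q(π/4) + f_q'(π/4) > 0; that is, the tangent line l_q(t) = f_q(π/4) + f_q'(π/4)·(t - π/4) of f_q at t = π/4 satisfies l_q(π/4 + 1) > 0. -/
open Matrix

noncomputable section

lemma aux_poly_s16 (x t : ℝ) (hx0 : 0 ≤ x) (hx1 : x ≤ 2/9) (ht0 : 0 ≤ t) (ht1 : t ≤ 1) :
    0 < (3*(x^2*((3-x)*t)) - 2*(1-x)^3 - 6)*(9*((3-x)*t)*((1-x)^3 - x^2*((3-x)*t))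
          - 3/2*((3-x)*(1-t))*(1-x)^3)
        - 54*((3-x)*t)*((1-x)^3 - x^2*((3-x)*t))*x*(3-3*x+x^2+x*((3-x)*t))
        + ((1-x)^3+3-3*(x^2*((3-x)*t)))*(27/4*(3-3*x+x^2+x*((3-x)*t))^2
          - 39/2*((3-x)*(1-t))*(1-x)^3) := by
  have hx2 : x^2 ≤ 2/9*x := by nlinarith
  have h0 : 0 < 45 + 561/4*x - 1935/4*x^2 + 1287/2*x^3 - 2193/4*x^4 + 603/2*x^5
      - 351/4*x^6 + 39/4*x^7 := by
    have e1 : 0 ≤ x*(561/4 - 1935/4*x) := mul_nonneg hx0 (by linarith)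
    have e2 : 0 ≤ x^3*(1287/2 - 2193/4*x) := mul_nonneg (by positivity) (by linarith)
    have e3 : 0 ≤ x^5*(603/2 - 351/4*x) := mul_nonneg (by positivity) (by linarith)
    have e4 : 0 ≤ x^7 := by positivity
    nlinarith
  have h1 : 0 < 39 + 659/4*x - 183*x^2 - 1317/4*x^3 + 671*x^4 - 1779/4*x^5
      + 261/2*x^6 - 29/2*x^7 := by
    have e1 : 0 ≤ x*(659/4 - 183*x - 1317/4*x^2) := mul_nonneg hx0 (by linarith)
    have e2 : 0 ≤ x^4*(671 - 1779/4*x) := mul_nonneg (by positivity) (by linarith)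
    have e3 : 0 ≤ x^6*(261/2 - 29/2*x) := mul_nonneg (by positivity) (by linarith)
    nlinarith
  have h2 : 0 < 33 + 757/4*x + 687/4*x^2 - 2841/4*x^3 + 850*x^4 - 987/2*x^5
      + 279/2*x^6 - 31/2*x^7 := by
    have e1 : 0 ≤ x*(757/4 + 687/4*x - 2841/4*x^2) := mul_nonneg hx0 (by linarith)
    have e2 : 0 ≤ x^4*(850 - 987/2*x) := mul_nonneg (by positivity) (by linarith)
    have e3 : 0 ≤ x^6*(279/2 - 31/2*x) := mul_nonneg (by positivity) (by linarith)
    nlinarith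
  have h3 : 0 < 27 + 855/4*x + 1161/2*x^2 - 999/2*x^3 + 171*x^4 - 27*x^5 := by
    have e1 : 0 ≤ x^2*(1161/2 - 999/2*x) := mul_nonneg (by positivity) (by linarith)
    have e2 : 0 ≤ x^4*(171 - 27*x) := mul_nonneg (by positivity) (by linarith)
    nlinarith
  have hu : 0 ≤ 1 - t := by linarith
  have key : 0 < (45 + 561/4*x - 1935/4*x^2 + 1287/2*x^3 - 2193/4*x^4 + 603/2*x^5
      - 351/4*x^6 + 39/4*x^7)*(1-t)^3 + 3*((39 + 659/4*x - 183*x^2 - 1317/4*x^3 + 671*x^4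
      - 1779/4*x^5 + 261/2*x^6 - 29/2*x^7)*((1-t)^2*t)) + 3*((33 + 757/4*x + 687/4*x^2
      - 2841/4*x^3 + 850*x^4 - 987/2*x^5 + 279/2*x^6 - 31/2*x^7)*((1-t)*t^2))
      + (27 + 855/4*x + 1161/2*x^2 - 999/2*x^3 + 171*x^4 - 27*x^5)*t^3 := by
    have m1 := mul_nonneg h1.le (mul_nonneg (pow_nonneg hu 2) ht0)
    have m2 := mul_nonneg h2.le (mul_nonneg hu (pow_nonneg ht0 2))
    have m0 := mul_nonneg h0.le (pow_nonneg hu 3)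
    have m3 := mul_nonneg h3.le (pow_nonneg ht0 3)
    rcases ht0.lt_or_eq with h | h
    · have := mul_pos h3 (pow_pos h 3)
      linarith
    · have h' : 0 < 1 - t := by linarith
      have := mul_pos h0 (pow_pos h' 3)
      linarith
  convert key using 1
  ring

lemma aux_core (R y : ℝ) (hR0 : 7/9 ≤ R) (hR1 : R < 1) (hy0 : 0 ≤ y)
    (hQ : 0 ≤ R^2*(1-y) + 2/R - 3) :
    0 < (-2+3*y-2*(3/R^3))*(9*R^2*y*(1-y) - 3/2*(R^2*(1-y) + 2/R - 3))
      - 54*R*y*(1-y)*(1/R^2 - R*(1-y))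
      + (1-3*y+3/R^3)*(27/4*(1/R^2 - R*(1-y))^2 - 39/2*(R^2*(1-y) + 2/R - 3)) := by
  have hR : 0 < R := by linarith
  obtain ⟨x, rfl⟩ : ∃ x, R = 1 - x := ⟨1 - R, by ring⟩
  have hx : 0 < x := by linarith
  have hx3 : 0 < 3 - x := by linarith
  obtain ⟨t, ht⟩ : ∃ t, y = x^2*(3-x)*t/(1-x)^3 :=
    ⟨y*(1-x)^3/(x^2*(3-x)), by field_simp⟩
  have hQe : (1-x)^2*(1-y) + 2/(1-x) - 3 = x^2*(3-x)*(1-t)/(1-x) := by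
    rw [ht]; field_simp; ring
  have ht0 : 0 ≤ t := by
    by_contra h
    push Not at h
    have : y < 0 := by
      rw [ht]
      apply div_neg_of_neg_of_pos _ (by positivity)
      exact mul_neg_of_pos_of_neg (by positivity) h
    linarith
  have ht1 : t ≤ 1 := by
    by_contra h
    push Not at h
    rw [hQe] at hQ
    have : x^2*(3-x)*(1-t)/(1-x) < 0 := by
      apply div_neg_of_neg_of_pos _ hR
      exact mul_neg_of_pos_of_neg (by positivity) (by linarith)
    linarith
  have hp := aux_poly_s16 x t hx.le (by linarith) ht0 ht1
  have hb : 1/(1-x)^2 - (1-x)*(1-y) = x*(3-3*x+x^2+x*((3-x)*t))/(1-x)^2 := by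
    rw [ht]; field_simp; ring
  rw [hQe, hb, ht]
  have hpp := mul_pos (div_pos (pow_pos hx 2) (pow_pos hR 7)) hp
  have hne : (1 - x) ≠ 0 := hR.ne'
  refine lt_of_lt_of_eq hpp ?_
  field_simp
  ring

/-- scaled bound -/
lemma aux_F (r0 R c s p : ℝ) (h0 : 0 < r0) (hR0 : 7/9 ≤ R) (hR1 : R < 1) (hc : 0 ≤ c)
    (hs : 0 ≤ s) (hcs : c^2 + s^2 = 1) (hp : 0 ≤ p)
    (hp2 : p^2 = 3/2*r0^2*(R^2*c^2+2/R-3)) (a b A B D : ℝ)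
    (ha : a = 3*r0*(R*c*s)) (hb : b = 3*r0*(R*c^2-1/R^2)) (hA : A = 1-3*c^2-2*(3/R^3))
    (hB : B = 3*c*s) (hD : D = 1-3*s^2+3/R^3) :
    0 < A*(a+p)*(a-p) + B*((a+p)*(b+3*p)+(b+p)*(a-p)) + D*(b+p)*(b+3*p) := by
  have hR : 0 < R := by linarith
  have hc2 : c^2 = 1 - s^2 := by linarith
  have hQ : 0 ≤ R^2*(1-s^2)+2/R-3 := by
    rw [← hc2]
    by_contra h
    push Not at h
    nlinarith [sq_nonneg p, mul_pos h0 h0]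
  have hcore := mul_pos (pow_pos h0 2) (aux_core R (s^2) hR0 hR1 (sq_nonneg s) hQ)
  have hk : 3 ≤ 3/R^3 := by
    rw [le_div_iff₀ (by positivity)]
    nlinarith [pow_le_one₀ hR.le hR1.le (n := 3)]
  have hD0 : 0 ≤ D := by rw [hD]; nlinarith [sq_nonneg c]
  have ha0 : 0 ≤ a := by rw [ha]; positivity
  have hB0 : 0 ≤ B := by rw [hB]; positivity
  have n1 : 0 ≤ B*a*p := by positivity
  have n2 : 0 ≤ B*p^2 := by positivity
  have n3 : 0 ≤ D*(b/2+4*p)^2 := by positivity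
  have e : A*a^2 - A*p^2 + 2*(B*a)*b + D*(3/4*b^2-13*p^2) =
    r0^2*((-2+3*s^2-2*(3/R^3))*(9*R^2*s^2*(1-s^2) - 3/2*(R^2*(1-s^2) + 2/R - 3))
      - 54*R*s^2*(1-s^2)*(1/R^2 - R*(1-s^2))
      + (1-3*s^2+3/R^3)*(27/4*(1/R^2 - R*(1-s^2))^2 - 39/2*(R^2*(1-s^2) + 2/R - 3))) := by
    have ea : a^2 = 9*r0^2*R^2*s^2*(1-s^2) := by rw [ha, ← hc2]; ring
    have eBa : B*a = 9*r0*R*s^2*(1-s^2) := by rw [ha, hB, ← hc2]; ring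
    rw [ea, eBa, hp2, hA, hD, hb, hc2]; ring
  rw [← e] at hcore
  nlinarith

lemma aux_rot (c s a b p K : ℝ) (h : c^2 + s^2 = 1) :
    (c*(a+p) - s*(b+p)) * ((-2 + K*(1-3*c^2))*(c*(a+p) - s*(b+p))
        + -3*c*s*K*(s*(a+p) + c*(b+p)))
      + (s*(a+p) + c*(b+p)) * (-3*c*s*K*(c*(a+p) - s*(b+p))
        + (1 + K*(1-3*s^2))*(s*(a+p) + c*(b+p)))
      + (-(p*(s+c)) * ((-2 + K*(1-3*c^2))*(c*(a+p) - s*(b+p))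
        + -3*c*s*K*(s*(a+p) + c*(b+p)))
      + p*(c-s) * (-3*c*s*K*(c*(a+p) - s*(b+p))
        + (1 + K*(1-3*s^2))*(s*(a+p) + c*(b+p)))) * 2
    = (1-3*c^2-2*K)*(a+p)*(a-p) + 3*c*s*((a+p)*(b+3*p)+(b+p)*(a-p))
      + (1-3*s^2+K)*(b+p)*(b+3*p) := by
  grind

/-- For every `q ∈ 𝔯⁺` with `|q| ≥ 0.54` (with polar angle `θ ∈ [0, π/2]`), one has
`f_q(π/4) + f_q'(π/4) > 0`, i.e. the tangent line `l_q` of `f_q` at `π/4` satisfies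
`l_q(π/4 + 1) > 0`. -/
theorem tangent_line_right_endpoint_positive (q : ℝ × ℝ) (hq : q ∈ HillRegionPlus)
    (hr : 0.54 ≤ nrm q) (θ : ℝ) (hθ : θ ∈ Set.Icc (0:ℝ) (Real.pi / 2))
    (hq1 : q.1 = nrm q * Real.cos θ) (hq2 : q.2 = nrm q * Real.sin θ) :
    0 < fq q θ (Real.pi / 4) + deriv (fq q θ) (Real.pi / 4) := by
  obtain ⟨⟨hreg, hlt, -⟩, hq10, hq20⟩ := hq
  have hd : HasDerivAt (fq q θ)
      ((![-(ρ q * Real.sin (θ + Real.pi/4)), ρ q * Real.cos (θ + Real.pi/4)]) ⬝ᵥ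
        (Hmat q).mulVec (w q + ρ q • ![Real.cos (θ + Real.pi/4), Real.sin (θ + Real.pi/4)]) * 2)
      (Real.pi/4) := by
    have hcos : HasDerivAt (fun α => Real.cos (θ + α)) (-Real.sin (θ + Real.pi/4)) (Real.pi/4) :=
      (Real.hasDerivAt_cos _).comp_const_add θ (Real.pi/4)
    have hsin : HasDerivAt (fun α => Real.sin (θ + α)) (Real.cos (θ + Real.pi/4)) (Real.pi/4) :=
      (Real.hasDerivAt_sin _).comp_const_add θ (Real.pi/4)
    have hX := (hcos.const_mul (ρ q)).const_add (w q 0)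
    have hY := (hsin.const_mul (ρ q)).const_add (w q 1)
    have := (((hX.mul hX).mul_const (Hmat q 0 0)).add
      ((hX.mul hY).mul_const (2 * Hmat q 0 1))).add ((hY.mul hY).mul_const (Hmat q 1 1))
    have hsym : Hmat q 1 0 = Hmat q 0 1 := by simp [Hmat]
    refine (this.congr_deriv ?_).congr_of_eventuallyEq (Filter.Eventually.of_forall fun α => ?_)
    · simp [Matrix.mulVec, dotProduct, Fin.sum_univ_two, hsym]
      ring
    · simp [fq, Matrix.mulVec, dotProduct, Fin.sum_univ_two, hsym]
      ring
  rw [hd.deriv]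
  set r := nrm q with hrdef
  set c := Real.cos θ with hcdef
  set s := Real.sin θ with hsdef
  have hc : 0 ≤ c := Real.cos_nonneg_of_mem_Icc ⟨by linarith [hθ.1, Real.pi_pos], hθ.2⟩
  have hs : 0 ≤ s := Real.sin_nonneg_of_mem_Icc ⟨hθ.1, by linarith [hθ.2, Real.pi_pos]⟩
  have hcs : c^2 + s^2 = 1 := Real.cos_sq_add_sin_sq θ
  have hrpos : 0 < r := by norm_num at hr; linarith
  obtain ⟨r0, hr0⟩ : ∃ r0 : ℝ, r0 = (3:ℝ) ^ (-(1:ℝ)/3) := ⟨_, rfl⟩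
  have h0 : 0 < r0 := by rw [hr0]; positivity
  have h03 : r0^3 = 1/3 := by
    rw [hr0, ← Real.rpow_natCast, ← Real.rpow_mul (by norm_num)]
    norm_num [Real.rpow_neg_one]
  have hC : (3:ℝ) ^ ((4:ℝ)/3) = 9*r0^2 := by
    rw [hr0, ← Real.rpow_natCast, ← Real.rpow_mul (by norm_num),
      show (9:ℝ) = (3:ℝ)^(2:ℝ) by norm_num, ← Real.rpow_add (by norm_num)]
    norm_num
  obtain ⟨R, hRr⟩ : ∃ R, r = r0 * R := ⟨r / r0, by field_simp⟩
  have hR : 0 < R := by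
    rw [hRr] at hrpos
    exact (mul_pos_iff_of_pos_left h0).mp hrpos
  have hr0ub : r0 ≤ 0.694 := by
    by_contra h
    push Not at h
    have := pow_lt_pow_left₀ h (by norm_num) (n := 3) (by norm_num)
    norm_num [h03] at this
  have hR0 : 7/9 ≤ R := by
    by_contra h
    push Not at h
    norm_num at hr hr0ub
    nlinarith
  have hinv : 1/r = 3*r0^2/R := by
    rw [hRr]; field_simp; linarith
  have hreg' : 0 < R^2*c^2+2/R-3 := by
    rw [hC, hinv, hq1, hRr] at hreg
    have : 0 < (3/2*r0^2)*(R^2*c^2+2/R-3) := by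
      have e : 3*r0^2/R + 3/2*(r0*R*c)^2 - 9*r0^2/2 = (3/2*r0^2)*(R^2*c^2+2/R-3) := by
        field_simp; ring
      linarith
    exact (mul_pos_iff_of_pos_left (by positivity)).mp this
  have hRc : R*c < 1 := by
    rw [← hr0, abs_of_nonneg hq10, hq1, hRr] at hlt
    by_contra h
    push Not at h
    nlinarith
  have hR1 : R < 1 := by
    by_contra h
    push Not at h
    have : 2/R ≤ 2 := by rw [div_le_iff₀ hR]; linarith
    have : (R*c)^2 < 1 := by
      have : 0 ≤ R*c := by positivity
      nlinarith
    nlinarith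
  obtain ⟨p, hpdef⟩ : ∃ p, p = ρ q * (Real.sqrt 2 / 2) := ⟨_, rfl⟩
  have hp : 0 ≤ p := by rw [hpdef]; unfold ρ; positivity
  have hρ2 : (ρ q)^2 = 3*r0^2*(R^2*c^2+2/R-3) := by
    have e : 3 * q.1 ^ 2 + 2 / nrm q - (3:ℝ) ^ ((4:ℝ)/3) = 3*r0^2*(R^2*c^2+2/R-3) := by
      rw [hC, ← hrdef, show 2/r = 2*(1/r) by ring, hinv, hq1, hRr]; field_simp; ring
    unfold ρ
    rw [e, Real.sq_sqrt (by positivity)]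
  have hp2 : p^2 = 3/2*r0^2*(R^2*c^2+2/R-3) := by
    rw [hpdef, mul_pow, hρ2, div_pow, Real.sq_sqrt (by norm_num)]; ring
  have hF := aux_F r0 R c s p h0 hR0 hR1 hc hs hcs hp hp2 _ _ _ _ _ rfl rfl rfl rfl rfl
  have hX : ρ q * Real.cos (θ + Real.pi/4) = p*(c-s) := by
    rw [Real.cos_add, Real.cos_pi_div_four, Real.sin_pi_div_four, hpdef]; ring
  have hY : ρ q * Real.sin (θ + Real.pi/4) = p*(s+c) := by
    rw [Real.sin_add, Real.cos_pi_div_four, Real.sin_pi_div_four, hpdef]; ring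
  have hk : 1/r^3 = 3/R^3 := by
    rw [hRr, mul_pow, h03]; field_simp
  have hr2 : 1/r^2 = 3*r0/R^2 := by
    rw [hRr]; field_simp; linarith
  -- components
  have hw0 : w q 0 = s*(3*r0/R^2) := by
    rw [← hr2]; simp only [w, ← hrdef, hq2]; simp; field_simp
  have hw1 : w q 1 = 3*r0*R*c - c*(3*r0/R^2) := by
    rw [← hr2]; simp only [w, ← hrdef, hq1]; simp; rw [hRr]; field_simp
  have hH00 : Hmat q 0 0 = -2 + 3/R^3*(1-3*c^2) := by
    rw [← hk]; simp only [Hmat, ← hrdef, hq1, hq2]; simp; field_simp; ring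
  have hH01 : Hmat q 0 1 = -3*c*s*(3/R^3) := by
    rw [← hk]; simp only [Hmat, ← hrdef, hq1, hq2]; simp; field_simp
  have hH10 : Hmat q 1 0 = -3*c*s*(3/R^3) := by
    rw [← hk]; simp only [Hmat, ← hrdef, hq1, hq2]; simp; field_simp
  have hH11 : Hmat q 1 1 = 1 + 3/R^3*(1-3*s^2) := by
    rw [← hk]; simp only [Hmat, ← hrdef, hq1, hq2]; simp; field_simp; ring
  have hs2 : s^2 = 1 - c^2 := by linarith
  simp only [fq, Matrix.mulVec, dotProduct, Fin.sum_univ_two, Pi.add_apply, Pi.smul_apply,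
    smul_eq_mul, Matrix.cons_val_zero, Matrix.cons_val_one, hX, hY]
  rw [hw0, hw1, hH00, hH01, hH10, hH11]
  generalize hK : 3/R^3 = K at *
  generalize hL : 3*r0/R^2 = L at *
  have hb : 3*r0*(R*c^2-1/R^2) = 3*r0*R*c^2 - L := by rw [← hL]; ring
  rw [hb] at hF
  generalize hM : 3*r0*R = M at *
  have ha : 3*r0*(R*c*s) = M*c*s := by rw [← hM]; ring
  rw [ha] at hF
  clear hd hreg hreg' hX hY hH00 hH01 hH10 hH11 hw0 hw1
  have e0 : s*L + p*(c-s) = c*(M*c*s+p) - s*(M*c^2-L+p) := by ring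
  have e1 : M*c - c*L + p*(s+c) = s*(M*c*s+p) + c*(M*c^2-L+p) := by
    linear_combination (-M*c)*hcs
  rw [e0, e1]
  generalize M*c*s = a at *
  generalize M*c^2-L = b at *
  refine lt_of_lt_of_eq hF ?_
  exact (aux_rot c s a b p K hcs).symm

end
end

section
/- For every q ∈ 𝔯⁺ with 0.54 ≤ |q| < 0.63, one has f_q(π/4) - f_q'(π/4) > 0; that is, the tangent line l_q(t) = f_q(π/4) + f_q'(π/4)·(t - π/4) of f_q at t = π/4 satisfies l_q(π/4 - 1) > 0. -/
open Matrix

noncomputable section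

lemma aux_g1 (r : ℝ) (h1 : 0.54 ≤ r) (h2 : r ≤ 0.63) :
    0 < 3 - 30*r^3 - 9*r^6 - 6*(16/25 - (3/2)*(25/16)*r^2)*(3-r^3)*r^2 + (21/2)*r^3*(1+r^3)
      + 6*r^3*(3*r^3+2-4.3267*r) := by
  obtain ⟨t, ht⟩ : ∃ t, t = r - 0.54 := ⟨_, rfl⟩
  obtain ⟨v, hv⟩ : ∃ v, v = 0.63 - r := ⟨_, rfl⟩
  have ht0 : 0 ≤ t := by linarith
  have hv0 : 0 ≤ v := by linarith
  have hr : r = (0.63*t + 0.54*v)/0.09 := by rw [ht, hv]; ring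
  have hone : (t+v)/0.09 = 1 := by rw [ht, hv]; norm_num
  have key : 3 - 30*r^3 - 9*r^6 - 6*(16/25 - (3/2)*(25/16)*r^2)*(3-r^3)*r^2 + (21/2)*r^3*(1+r^3)
      + 6*r^3*(3*r^3+2-4.3267*r) =
    3*((t+v)/0.09)^7 - 30*r^3*((t+v)/0.09)^4 - 9*r^6*((t+v)/0.09) - 6*(16/25*((t+v)/0.09)^2 - (3/2)*(25/16)*r^2)*(3*((t+v)/0.09)^3-r^3)*r^2 + (21/2)*r^3*(((t+v)/0.09)^3+r^3)*((t+v)/0.09)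
      + 6*r^3*(3*r^3+2*((t+v)/0.09)^3-4.3267*r*((t+v)/0.09)^2)*((t+v)/0.09) := by
    rw [hone]; ring
  have hpos : 0 < t + v := by rw [ht, hv]; norm_num
  rw [key, hr]
  ring_nf
  rcases ht0.eq_or_lt with h | h
  · subst h
    have : 0 < v := by linarith
    ring_nf; positivity
  · positivity

lemma aux_g0 (r : ℝ) (h1 : 0.54 ≤ r) (h2 : r ≤ 0.63) :
    0 < (1-3*r^3)^2*(1+r^3) - (3*r^3+2-4.3267*r)/2*r^3*(6*(25/16)*r*(3-r^3)+7*(1+r^3)) := by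
  obtain ⟨t, ht⟩ : ∃ t, t = r - 0.54 := ⟨_, rfl⟩
  obtain ⟨v, hv⟩ : ∃ v, v = 0.63 - r := ⟨_, rfl⟩
  have ht0 : 0 ≤ t := by linarith
  have hv0 : 0 ≤ v := by linarith
  have hr : r = (0.63*t + 0.54*v)/0.09 := by rw [ht, hv]; ring
  have hone : (t+v)/0.09 = 1 := by rw [ht, hv]; norm_num
  have key : (1-3*r^3)^2*(1+r^3) - (3*r^3+2-4.3267*r)/2*r^3*(6*(25/16)*r*(3-r^3)+7*(1+r^3)) =
    (((t+v)/0.09)^3-3*r^3)^2*(((t+v)/0.09)^3+r^3)*((t+v)/0.09) - (3*r^3+2*((t+v)/0.09)^3-4.3267*r*((t+v)/0.09)^2)/2*r^3*(6*(25/16)*r*(3*((t+v)/0.09)^3-r^3)+7*(((t+v)/0.09)^3+r^3)*((t+v)/0.09)) := by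
    rw [hone]; ring
  have hpos : 0 < t + v := by rw [ht, hv]; norm_num
  rw [key, hr]
  ring_nf
  rcases ht0.eq_or_lt with h | h
  · subst h
    have : 0 < v := by linarith
    ring_nf; positivity
  · positivity

set_option maxHeartbeats 2000000 in
lemma aux_ineq_s17 (r p c s g k : ℝ) (h1 : 0.54 ≤ r) (h2 : r ≤ 0.63) (hp : r * p = 1)
    (hc0 : 0 ≤ c) (hs0 : 0 ≤ s) (hcs : c^2+s^2 = 1) (hg : 0 ≤ g) (hk : 4.3267 ≤ k)
    (hg2 : 2*g^2 = 3*r^2*c^2 + 2*p - k) :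
    0 < (27*p*s^4 + s^2*(3*p^4-30*p-9*r^2) + (p^2-3*r)^2*(p^3+1))
      + 4*(3*c*s*(r-3*p^2))*g + (-7*p^3-7*c^2+5*s^2+6*c*s)*g^2 := by
  have hr0 : 0 < r := by linarith
  have hp0 : 0 < p := by
    by_contra h; push Not at h; nlinarith
  have hp1 : 1 ≤ p := by
    by_contra h; push Not at h; nlinarith
  have hc1 : c ≤ 1 := by nlinarith
  have e0 : (1-3*r^3)^2*(1+r^3) - (3*r^3+2-4.3267*r)/2*r^3*(6*(25/16)*r*(3-r^3)+7*(1+r^3))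
     = r^7 * ((p^2-3*r)^2*(p^3+1) - (3*r^2+2*p-4.3267)/2*(6*(25/16)*(3*p^2-r)+7*p^3+7)) := by
    have : p = 1/r := by field_simp; linarith
    rw [this]; field_simp; ring
  have e1 : 3 - 30*r^3 - 9*r^6 - 6*(16/25 - (3/2)*(25/16)*r^2)*(3-r^3)*r^2 + (21/2)*r^3*(1+r^3)
      + 6*r^3*(3*r^3+2-4.3267*r) = r^4*(3*p^4-30*p-9*r^2-6*(16/25-(3/2)*(25/16)*r^2)*(3*p^2-r)
        + (7*p^3+7)*(3/2)*r^2+6*(3*r^2+2*p-4.3267)) := by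
    have : p = 1/r := by field_simp; linarith
    rw [this]; field_simp; ring
  have g0 := aux_g0 r h1 h2
  have g1 := aux_g1 r h1 h2
  rw [e0] at g0
  rw [e1] at g1
  have g0 := pos_of_mul_pos_right g0 (by positivity)
  have g1 := pos_of_mul_pos_right g1 (by positivity)
  have hx : s^2 ≤ 1 := by nlinarith
  have hx0 : 0 ≤ s^2 := by positivity
  have hp2 : 1 ≤ p^2 := one_le_pow₀ hp1
  have hr2 : r^2 ≤ 1 := by
    apply pow_le_one₀ hr0.le; linarith
  have hD : 0 ≤ 3*p^2 - r := by linarith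
  have hp3 : 1 ≤ p^3 := one_le_pow₀ hp1
  have g2 : 0 ≤ 27*p - 18*r^2 := by linarith
  -- AM-GM
  have am : c*s*g ≤ (16/25*s^2 + 25/16*g^2)/2 := by
    have : c*(s*g) ≤ 1*(s*g) := mul_le_mul_of_nonneg_right hc1 (by positivity)
    nlinarith [sq_nonneg (16/25*s - g)]
  have am2 := mul_le_mul_of_nonneg_left am hD
  have hS : g^2 ≤ (3*r^2+2*p-4.3267)/2 - 3/2*r^2*s^2 := by
    have : c^2 = 1 - s^2 := by linarith
    rw [this] at hg2; linarith
  have hK : 0 ≤ 6*(25/16)*(3*p^2-r)+7*p^3+7-12*s^2 := by linarith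
  have hS2 := mul_le_mul_of_nonneg_left hS hK
  have hcsg : 0 ≤ c*s*g^2 := by positivity
  have hc2 : c^2*g^2 = g^2 - s^2*g^2 := by
    have : c^2 = 1 - s^2 := by linarith
    rw [this]; ring
  have m1 := mul_nonneg hx0 g1.le
  have m2 := mul_nonneg (mul_nonneg hx0 hx0) g2
  linear_combination 12*am2 + hS2 + 6*hcsg + 7*hc2 + m1 + m2 + g0

lemma aux_ident (r p c s g : ℝ) (hp : r * p = 1) (hcs : c^2+s^2 = 1) :
   let h11 := -2 + p^3 - 3*p^3*c^2
   let h12 := -3*p^3*c*s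
   let h22 := 1 + p^3 - 3*p^3*s^2
   let v1 := p^2*s + g*(c-s)
   let v2 := 3*r*c - p^2*c + g*(s+c)
   let d1 := - (g*(s+c))
   let d2 := g*(c-s)
   (h11*v1^2+2*h12*v1*v2+h22*v2^2) - (h11*(2*v1*d1)+2*h12*(d1*v2+v1*d2)+h22*(2*v2*d2)) = 
   (27*p*s^4 + s^2*(3*p^4-30*p-9*r^2) + (p^2-3*r)^2*(p^3+1))
      + 4*(3*c*s*(r-3*p^2))*g + (-7*p^3-7*c^2+5*s^2+6*c*s)*g^2 := by
  intros
  grind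

lemma aux_k : (4.3267:ℝ) ≤ (3:ℝ) ^ ((4:ℝ)/3) := by
  have h : ((3:ℝ) ^ ((4:ℝ)/3))^3 = 81 := by
    rw [← Real.rpow_natCast, ← Real.rpow_mul (by norm_num)]
    norm_num
  have h0 : 0 ≤ (3:ℝ) ^ ((4:ℝ)/3) := by positivity
  by_contra hlt
  push Not at hlt
  have := pow_lt_pow_left₀ hlt h0 (n := 3) (by norm_num)
  rw [h] at this
  norm_num at this

lemma aux_deriv (h11 h12 h22 w1 w2 R θ α : ℝ) :
    HasDerivAt (fun α => h11*(w1+R*Real.cos (θ+α))^2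
        + 2*h12*((w1+R*Real.cos (θ+α))*(w2+R*Real.sin (θ+α))) + h22*(w2+R*Real.sin (θ+α))^2)
      (h11*(2*(w1+R*Real.cos (θ+α))*(-(R*Real.sin (θ+α))))
        + 2*h12*((-(R*Real.sin (θ+α)))*(w2+R*Real.sin (θ+α))
          + (w1+R*Real.cos (θ+α))*(R*Real.cos (θ+α)))
        + h22*(2*(w2+R*Real.sin (θ+α))*(R*Real.cos (θ+α)))) α := by
  have hid : HasDerivAt (fun α : ℝ => θ + α) 1 α := (hasDerivAt_id α).const_add θ
  have h1 : HasDerivAt (fun α => w1+R*Real.cos (θ+α)) (-(R*Real.sin (θ+α))) α := by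
    exact ((hid.cos.const_mul R).const_add w1).congr_deriv (by ring)
  have h2 : HasDerivAt (fun α => w2+R*Real.sin (θ+α)) (R*Real.cos (θ+α)) α := by
    exact ((hid.sin.const_mul R).const_add w2).congr_deriv (by ring)
  exact ((((h1.pow 2).const_mul h11).add ((h1.mul h2).const_mul (2*h12))).add
    ((h2.pow 2).const_mul h22)).congr_deriv (by norm_num)

/-- For every `q ∈ 𝔯⁺` with `0.54 ≤ |q| < 0.63` (with polar angle `θ ∈ [0, π/2]`),
one has `f_q(π/4) - f_q'(π/4) > 0`, i.e. the tangent line `l_q` of `f_q` at `π/4`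
satisfies `l_q(π/4 - 1) > 0`. -/
theorem tangent_line_left_endpoint_positive (q : ℝ × ℝ) (hq : q ∈ HillRegionPlus)
    (hr : 0.54 ≤ nrm q) (hr' : nrm q < 0.63)
    (θ : ℝ) (hθ : θ ∈ Set.Icc (0:ℝ) (Real.pi / 2))
    (hq1 : q.1 = nrm q * Real.cos θ) (hq2 : q.2 = nrm q * Real.sin θ) :
    0 < fq q θ (Real.pi / 4) - deriv (fq q θ) (Real.pi / 4) := by
  obtain ⟨⟨hH, -, -⟩, -, -⟩ := hq
  set r := nrm q with hrdef
  have hr0 : 0 < r := by norm_num at hr; linarith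
  obtain ⟨p, hpdef⟩ : ∃ p, p = 1 / r := ⟨_, rfl⟩
  have hp : r * p = 1 := by rw [hpdef]; field_simp
  have hc0 : 0 ≤ Real.cos θ :=
    Real.cos_nonneg_of_mem_Icc ⟨by linarith [hθ.1, Real.pi_pos], hθ.2⟩
  have hs0 : 0 ≤ Real.sin θ :=
    Real.sin_nonneg_of_nonneg_of_le_pi hθ.1 (by linarith [hθ.2, Real.pi_pos])
  have hcs : Real.cos θ ^ 2 + Real.sin θ ^ 2 = 1 := Real.cos_sq_add_sin_sq θ
  have hρ : ρ q ^ 2 = 3 * r^2 * Real.cos θ ^ 2 + 2 * p - (3:ℝ) ^ ((4:ℝ)/3) := by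
    unfold ρ
    rw [← hrdef, Real.sq_sqrt]
    · rw [hq1, hpdef]; ring
    · have : 2 / r = 2 * (1 / r) := by ring
      rw [this]; linarith
  have hρ0 : 0 ≤ ρ q := Real.sqrt_nonneg _
  set c := Real.cos θ
  set s := Real.sin θ
  have hf : fq q θ = fun α => (-2 + p^3 - 3*p^3*c^2)*(p^2*s+ρ q*Real.cos (θ+α))^2
        + 2*(-3*p^3*c*s)*((p^2*s+ρ q*Real.cos (θ+α))*((3*r*c - p^2*c)+ρ q*Real.sin (θ+α)))
        + (1 + p^3 - 3*p^3*s^2)*((3*r*c - p^2*c)+ρ q*Real.sin (θ+α))^2 := by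
    funext α
    have hw1 : q.2 / r^3 = p^2 * s := by rw [hq2, hpdef]; field_simp
    have hw2 : 3 * q.1 - q.1 / r^3 = 3*r*c - p^2*c := by rw [hq1, hpdef]; field_simp
    have e11 : 1 / r^5 * (-2 * r^5 + r^2 - 3 * q.1^2) = -2 + p^3 - 3*p^3*c^2 := by
      rw [hq1, hpdef]; field_simp
    have e12 : 1 / r^5 * (-3 * q.1 * q.2) = -3*p^3*c*s := by
      rw [hq1, hq2, hpdef]; field_simp
    have e22 : 1 / r^5 * (r^5 + r^2 - 3 * q.2^2) = 1 + p^3 - 3*p^3*s^2 := by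
      rw [hq2, hpdef]; field_simp
    rw [← e11, ← e12, ← e22, ← hw1, ← hw2]
    simp only [fq, w, Hmat, ← hrdef, dotProduct, Matrix.mulVec, Fin.sum_univ_two, Matrix.smul_apply,
      Pi.add_apply, Pi.smul_apply, smul_eq_mul, Matrix.of_apply, Matrix.cons_val_zero,
      Matrix.cons_val_one, Matrix.cons_val', Matrix.cons_val_fin_one]
    ring
  rw [hf, (aux_deriv _ _ _ _ _ _ _ _).deriv]
  have hcos : ρ q * Real.cos (θ + Real.pi/4) = (ρ q * (√2/2)) * (c - s) := by
    rw [Real.cos_add, Real.cos_pi_div_four, Real.sin_pi_div_four]; ring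
  have hsin : ρ q * Real.sin (θ + Real.pi/4) = (ρ q * (√2/2)) * (s + c) := by
    rw [Real.sin_add, Real.cos_pi_div_four, Real.sin_pi_div_four]; ring
  have hg2 : 2 * (ρ q * (√2/2))^2 = 3 * r^2 * c^2 + 2 * p - (3:ℝ) ^ ((4:ℝ)/3) := by
    rw [← hρ, mul_pow, div_pow, Real.sq_sqrt (by norm_num)]; ring
  have main := aux_ineq_s17 r p c s (ρ q * (√2/2)) _ hr hr'.le hp hc0 hs0 hcs (by positivity) aux_k hg2
  rw [← aux_ident r p c s _ hp hcs] at main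
  simp only [hcos, hsin]
  refine lt_of_lt_of_eq main ?_
  ring

end
end
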